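/- For every constant c ∈ (0, 1/2] there exists a constant c' > 0 (depending only on c) such that the following holds: for all positive integers N and K with min(K, N−K) ≥ cN, if P is a random N×N matrix whose N rows are independent and each uniformly distributed over the set of vectors in {0,1}^N having exactly K entries equal to 1, then the probability that P is invertible as a real matrix is at least 1 − 2e^{−c'N}. -/

import Mathlib

open Matrix
open scoped BigOperators

/-- The probability of the event `p` under the uniform distribution on a finite type. -/
noncomputable def prob {Ω : Type*} [Fintype Ω] (p : Ω → Prop) : ℝ :=
  open Classical in 𝔼 ω, if p ω then (1 : ℝ) else 0

section Prob

variable {Ω Ω' : Type*} [Fintype Ω] [Fintype Ω']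

lemma prob_eq_expect (p : Ω → Prop) [DecidablePred p] :
    prob p = 𝔼 ω, if p ω then (1 : ℝ) else 0 := by
  unfold prob
  refine Finset.expect_congr rfl fun ω _ => ?_
  congr

lemma prob_eq_card_div (p : Ω → Prop) [DecidablePred p] :
    prob p = (Finset.univ.filter p).card / Fintype.card Ω := by
  rw [prob_eq_expect, Fintype.expect_eq_sum_div_card, Finset.sum_boole]

lemma prob_nonneg (p : Ω → Prop) : 0 ≤ prob p := by
  classical
  rw [prob_eq_card_div]
  positivity

lemma prob_le_one (p : Ω → Prop) : prob p ≤ 1 := by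
  classical
  rw [prob_eq_card_div]
  refine div_le_one_of_le₀ ?_ (by positivity)
  exact_mod_cast Finset.card_le_univ _

lemma prob_mono {p q : Ω → Prop} (h : ∀ ω, p ω → q ω) : prob p ≤ prob q := by
  classical
  rw [prob_eq_expect, prob_eq_expect]
  refine Finset.expect_le_expect fun ω _ => ?_
  by_cases hp : p ω
  · simp [hp, h ω hp]
  · simp only [hp, if_false]
    split_ifs <;> norm_num

lemma prob_eq_zero {p : Ω → Prop} (h : ∀ ω, ¬ p ω) : prob p = 0 := by
  classical
  simp [prob_eq_expect, h]

lemma prob_exists_le {κ : Type*} (s : Finset κ) (p : κ → Ω → Prop) :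
    prob (fun ω => ∃ i ∈ s, p i ω) ≤ ∑ i ∈ s, prob (p i) := by
  classical
  simp_rw [prob_eq_expect]
  rw [← Finset.expect_sum_comm]
  refine Finset.expect_le_expect fun ω _ => ?_
  have hnn : ∀ i ∈ s, (0 : ℝ) ≤ if p i ω then 1 else 0 := fun i _ => by split_ifs <;> norm_num
  split_ifs with h
  · obtain ⟨i, hi, hpi⟩ := h
    refine le_trans ?_ (Finset.single_le_sum hnn hi)
    simp [hpi]
  · exact Finset.sum_nonneg hnn

lemma prob_or_le (p q : Ω → Prop) : prob (fun ω => p ω ∨ q ω) ≤ prob p + prob q := by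
  classical
  simp_rw [prob_eq_expect]
  rw [← Finset.expect_add_distrib]
  refine Finset.expect_le_expect fun ω _ => ?_
  by_cases hp : p ω <;> by_cases hq : q ω <;> simp [hp, hq]

lemma prob_not [Nonempty Ω] (p : Ω → Prop) : prob (fun ω => ¬ p ω) = 1 - prob p := by
  classical
  simp_rw [prob_eq_expect]
  rw [← Fintype.expect_one (ι := Ω) (M := ℝ), ← Finset.expect_sub_distrib]
  refine Finset.expect_congr rfl fun ω _ => ?_
  by_cases hp : p ω <;> simp [hp]

lemma prob_equiv (e : Ω ≃ Ω') (p : Ω' → Prop) : prob (fun ω => p (e ω)) = prob p := by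
  classical
  simp_rw [prob_eq_expect]
  exact Fintype.expect_equiv e _ _ fun _ => rfl

lemma prob_prod (p : Ω × Ω' → Prop) : prob p = 𝔼 a, prob (fun b => p (a, b)) := by
  classical
  simp_rw [prob_eq_expect]
  rw [← Finset.univ_product_univ, Finset.expect_product]

lemma prob_forall {ι : Type*} [Fintype ι] [DecidableEq ι] (p : ι → Ω → Prop) :
    prob (fun f : ι → Ω => ∀ i, p i (f i)) = ∏ i, prob (p i) := by
  classical
  simp_rw [prob_eq_card_div]
  rw [Finset.prod_div_distrib, Finset.prod_const, Finset.card_univ, Fintype.card_fun,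
    ← Nat.cast_prod, ← Fintype.card_piFinset]
  push_cast
  congr 3
  ext f
  simp

end Prob

/-- Conditioning on the coordinates in `R`: the other coordinates are independent. -/
lemma expect_ite_forall_notMem {ι α : Type*} [Fintype ι] [DecidableEq ι] [Fintype α]
    (R : Finset ι) (S : (R → α) → α → Prop) (w : (R → α) → ℝ)
    [∀ f : ι → α, Decidable (∀ j ∉ R, S (fun i => f i) (f j))] :
    (𝔼 f : ι → α, if ∀ j ∉ R, S (fun i => f i) (f j) then w (fun i => f i) else 0) =
      𝔼 g : R → α, w g * prob (S g) ^ (Fintype.card ι - R.card) := by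
  classical
  have hcard : Fintype.card {i // i ∉ R} = Fintype.card ι - R.card := by
    rw [Fintype.card_subtype_compl, Fintype.card_coe]
  have key : ∀ g : R → α, w g * prob (S g) ^ (Fintype.card ι - R.card) =
      𝔼 h : {i // i ∉ R} → α, if ∀ j, S g (h j) then w g else 0 := by
    intro g
    rw [← hcard, ← Finset.card_univ, ← Finset.prod_const,
      ← prob_forall (fun (_ : {i // i ∉ R}) => S g), prob_eq_expect, Finset.mul_expect]
    simp
  simp_rw [key]
  rw [← Finset.expect_product', Finset.univ_product_univ]
  refine Fintype.expect_equiv (Equiv.piEquivPiSubtypeProd (fun i => i ∈ R) fun _ => α) _ _ ?_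
  intro f
  simp [Equiv.piEquivPiSubtypeProd]

lemma prob_forall_notMem_le {ι α : Type*} [Fintype ι] [DecidableEq ι] [Fintype α] [Nonempty α]
    (R : Finset ι) (S : (R → α) → α → Prop) {p : ℝ} (hp : ∀ g, prob (S g) ≤ p) :
    prob (fun f : ι → α => ∀ j ∉ R, S (fun i => f i) (f j)) ≤
      p ^ (Fintype.card ι - R.card) := by
  classical
  rw [prob_eq_expect, expect_ite_forall_notMem R S (fun _ => 1)]
  refine (Finset.expect_le_expect (g := fun _ => p ^ (Fintype.card ι - R.card))
    fun g _ => ?_).trans_eq (Fintype.expect_const _)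
  rw [one_mul]
  exact pow_le_pow_left₀ (prob_nonneg _) (hp g) _

section Span

variable {K V ι : Type*} [Field K] [AddCommGroup V] [Module K V]

/-- If every subspace of small dimension is much less likely than `W`, then vectors conditioned
to lie in `W` are likely to be linearly independent. -/
lemma half_prob_pow_le_prob_linearIndependent {𝒴 : Type*} [Fintype 𝒴] [Nonempty 𝒴] (y : 𝒴 → V)
    (m : ℕ) (W : Submodule K V)
    (hW : ∀ W' : Submodule K V, Module.finrank K W' < m →
      m * prob (fun η => y η ∈ W') ≤ prob (fun η => y η ∈ W) / 2) :
    prob (fun η => y η ∈ W) ^ m / 2 ≤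
      prob (fun Y : Fin m → 𝒴 => (∀ i, y (Y i) ∈ W) ∧ LinearIndependent K (y ∘ Y)) := by
  classical
  set b := prob (fun η => y η ∈ W) with hb
  have hb0 : 0 ≤ b := prob_nonneg _
  rcases Nat.eq_zero_or_pos m with rfl | hm
  · have : prob (fun Y : Fin 0 → 𝒴 => (∀ i, y (Y i) ∈ W) ∧ LinearIndependent K (y ∘ Y)) = 1 := by
      rw [prob_eq_expect]
      simp
    rw [this]
    norm_num
  have hm' : (0 : ℝ) < m := by exact_mod_cast hm
  have hall : prob (fun Y : Fin m → 𝒴 => ∀ i, y (Y i) ∈ W) = b ^ m := by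
    rw [prob_forall (fun _ η => y η ∈ W)]
    simp [hb]
  let bad : Fin m → (Fin m → 𝒴) → Prop := fun i Y =>
    (∀ j : ↥(Finset.univ.erase i), y (Y j) ∈ W) ∧
      y (Y i) ∈ Submodule.span K (Set.range fun j : ↥(Finset.univ.erase i) => y (Y j))
  have hbad : ∀ i, prob (bad i) ≤ b ^ m / (2 * m) := by
    intro i
    let w : (↥(Finset.univ.erase i) → 𝒴) → ℝ := fun g => if ∀ j, y (g j) ∈ W then 1 else 0
    let S : (↥(Finset.univ.erase i) → 𝒴) → 𝒴 → Prop := fun g η =>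
      y η ∈ Submodule.span K (Set.range fun j => y (g j))
    have h1 : prob (bad i) = 𝔼 f : Fin m → 𝒴,
        if ∀ j ∉ Finset.univ.erase i, S (fun i => f i) (f j) then w (fun i => f i) else 0 := by
      rw [prob_eq_expect]
      refine Finset.expect_congr rfl fun f _ => ?_
      simp only [bad, S, w, Finset.mem_erase, Finset.mem_univ, and_true, not_not, forall_eq]
      by_cases h : y (f i) ∈ Submodule.span K
          (Set.range fun j : ↥(Finset.univ.erase i) => y (f j)) <;> simp [h]
    have hcard : Fintype.card (Fin m) - (Finset.univ.erase i).card = 1 := by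
      rw [Finset.card_erase_of_mem (Finset.mem_univ _)]
      simp
      omega
    have hcard' : Fintype.card ↥(Finset.univ.erase i) = m - 1 := by
      rw [Fintype.card_coe, Finset.card_erase_of_mem (Finset.mem_univ _)]
      simp
    rw [h1, expect_ite_forall_notMem, hcard]
    have h2 : ∀ g, prob (S g) ≤ b / (2 * m) := by
      intro g
      have := hW (Submodule.span K (Set.range fun j => y (g j)))
        ((finrank_range_le_card _).trans_lt (by rw [hcard']; omega))
      rw [le_div_iff₀ (by positivity)]
      simp only [S]
      linarith
    calc 𝔼 g, w g * prob (S g) ^ 1 ≤ 𝔼 g, w g * (b / (2 * m)) := by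
          refine Finset.expect_le_expect fun g _ => ?_
          rw [pow_one]
          refine mul_le_mul_of_nonneg_left (h2 g) ?_
          simp only [w]
          split_ifs <;> norm_num
      _ = b ^ (m - 1) * (b / (2 * m)) := by
          rw [← Finset.expect_mul]
          congr 1
          have := prob_forall
            (fun (_ : ↥(Finset.univ.erase i)) (η : 𝒴) => y η ∈ W)
          rw [prob_eq_expect, Finset.prod_const, Finset.card_univ, hcard'] at this
          exact this
      _ = b ^ m / (2 * m) := by
          rw [← mul_div_assoc, ← pow_succ, Nat.sub_add_cancel hm]
  have hsplit : prob (fun Y : Fin m → 𝒴 => ∀ i, y (Y i) ∈ W) ≤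
      prob (fun Y : Fin m → 𝒴 => (∀ i, y (Y i) ∈ W) ∧ LinearIndependent K (y ∘ Y)) +
        prob (fun Y : Fin m → 𝒴 => ∃ i ∈ Finset.univ, bad i Y) := by
    refine le_trans (prob_mono fun Y hY => ?_) (prob_or_le _ _)
    by_cases hli : LinearIndependent K (y ∘ Y)
    · exact Or.inl ⟨hY, hli⟩
    · right
      rw [linearIndependent_iff_notMem_span] at hli
      push Not at hli
      obtain ⟨i, hi⟩ := hli
      refine ⟨i, Finset.mem_univ _, fun j => hY j, ?_⟩
      change y (Y i) ∈ _ at hi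
      convert hi using 3
      ext v
      simp
  have hsum : prob (fun Y : Fin m → 𝒴 => ∃ i ∈ Finset.univ, bad i Y) ≤ b ^ m / 2 := by
    refine (prob_exists_le _ _).trans ((Finset.sum_le_sum fun i _ => hbad i).trans_eq ?_)
    rw [Finset.sum_const, Finset.card_univ, Fintype.card_fin, nsmul_eq_mul]
    field_simp
  rw [hall] at hsplit
  linarith

variable [FiniteDimensional K V]

lemma exists_card_le_sup_span_eq (x : ι → V) (r : ℕ) (B : Submodule K V)
    (h : Module.finrank K ↥(B ⊔ Submodule.span K (Set.range x)) ≤ Module.finrank K B + r) :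
    ∃ R : Finset ι, R.card ≤ r ∧
      B ⊔ Submodule.span K (x '' R) = B ⊔ Submodule.span K (Set.range x) := by
  classical
  induction r generalizing B with
  | zero =>
    refine ⟨∅, le_rfl, ?_⟩
    simpa using Submodule.eq_of_le_of_finrank_le le_sup_left h
  | succ r ih =>
    by_cases hB : ∀ i, x i ∈ B
    · refine ⟨∅, Nat.zero_le _, ?_⟩
      have : Submodule.span K (Set.range x) ≤ B :=
        Submodule.span_le.2 (Set.range_subset_iff.2 hB)
      simp [this]
    · push Not at hB
      obtain ⟨i, hi⟩ := hB
      have hlt : B < B ⊔ Submodule.span K {x i} := by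
        refine lt_of_le_of_ne le_sup_left fun he => hi ?_
        rw [he]
        exact Submodule.mem_sup_right (Submodule.mem_span_singleton_self _)
      have hfin := Submodule.finrank_lt_finrank_of_lt hlt
      have hsup : B ⊔ Submodule.span K {x i} ⊔ Submodule.span K (Set.range x) =
          B ⊔ Submodule.span K (Set.range x) := by
        have hle : Submodule.span K {x i} ≤ Submodule.span K (Set.range x) :=
          Submodule.span_mono (Set.singleton_subset_iff.2 (Set.mem_range_self i))
        rw [sup_assoc, sup_eq_right.2 hle]
      obtain ⟨R, hR, hRe⟩ := ih (B ⊔ Submodule.span K {x i}) (by rw [hsup]; omega)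
      refine ⟨insert i R, (Finset.card_insert_le _ _).trans (by omega), ?_⟩
      rw [Finset.coe_insert, Set.image_insert_eq, Set.insert_eq, Submodule.span_union,
        ← sup_assoc, hRe, hsup]

lemma exists_card_eq_sup_span_eq [Fintype ι] (x : ι → V) {r : ℕ} (hr : r ≤ Fintype.card ι)
    (B : Submodule K V)
    (h : Module.finrank K ↥(B ⊔ Submodule.span K (Set.range x)) ≤ Module.finrank K B + r) :
    ∃ R : Finset ι, R.card = r ∧
      B ⊔ Submodule.span K (x '' R) = B ⊔ Submodule.span K (Set.range x) := by
  obtain ⟨R, hR, hRe⟩ := exists_card_le_sup_span_eq x r B h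
  obtain ⟨R', hRR', hR'⟩ := Finset.exists_superset_card_eq hR hr
  refine ⟨R', hR', le_antisymm (sup_le_sup_left (Submodule.span_mono (by simp)) _) ?_⟩
  rw [← hRe]
  exact sup_le_sup_left (Submodule.span_mono (Set.image_mono (by exact_mod_cast hRR'))) _

/-- If the distribution of `y` dominates that of `x` on all the subspaces in a family, by a
constant factor, then it is unlikely that copies of `x` span a member of the family. -/
lemma prob_span_mem_le {𝒳 𝒴 : Type*} [Fintype 𝒳] [Nonempty 𝒳] [Fintype 𝒴] [Nonempty 𝒴]
    (x : 𝒳 → V) (y : 𝒴 → V) {N m : ℕ} (hN : Module.finrank K V ≤ N) (hm : m ≤ N)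
    {q : ℝ} (hq0 : 0 ≤ q)
    (F : Submodule K V → Prop)
    (hpos : ∀ W, F W → 0 < prob (fun η => y η ∈ W))
    (hq : ∀ W, F W → prob (fun ξ => x ξ ∈ W) ≤ q * prob (fun η => y η ∈ W))
    (hW : ∀ W, F W → ∀ W' : Submodule K V, Module.finrank K W' < m →
      m * prob (fun η => y η ∈ W') ≤ prob (fun η => y η ∈ W) / 2) :
    prob (fun X : Fin N → 𝒳 => F (Submodule.span K (Set.range (x ∘ X)))) ≤
      2 * N.choose m * q ^ m := by
  classical
  let sp : (Fin N → 𝒳) → Submodule K V := fun X => Submodule.span K (Set.range (x ∘ X))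
  let b : Submodule K V → ℝ := fun W => prob (fun η => y η ∈ W)
  let good : (Fin m → 𝒴) → Submodule K V → Prop := fun Y W =>
    (∀ i, y (Y i) ∈ W) ∧ LinearIndependent K (y ∘ Y)
  let sp' : (Fin m → 𝒴) → (R : Finset (Fin N)) → (R → 𝒳) → Submodule K V := fun Y R g =>
    Submodule.span K (Set.range (y ∘ Y)) ⊔ Submodule.span K (Set.range fun i => x (g i))
  let w : (Fin m → 𝒴) → (R : Finset (Fin N)) → (R → 𝒳) → ℝ := fun Y R g =>
    if F (sp' Y R g) then 2 / b (sp' Y R g) ^ m else 0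
  have hw : ∀ Y R g, 0 ≤ w Y R g := by
    intro Y R g
    simp only [w]
    split_ifs
    · have : 0 ≤ b (sp' Y R g) := prob_nonneg _
      positivity
    · exact le_rfl
  have step1 : prob (fun X => F (sp X)) ≤
      𝔼 X, 𝔼 Y, if F (sp X) ∧ good Y (sp X) then 2 / b (sp X) ^ m else 0 := by
    rw [prob_eq_expect]
    refine Finset.expect_le_expect fun X _ => ?_
    by_cases hF : F (sp X)
    · have hb : 0 < b (sp X) := hpos _ hF
      have h := half_prob_pow_le_prob_linearIndependent y m (sp X) (hW _ hF)
      have heq : (𝔼 Y, if F (sp X) ∧ good Y (sp X) then 2 / b (sp X) ^ m else 0) =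
          prob (fun Y => good Y (sp X)) * (2 / b (sp X) ^ m) := by
        rw [prob_eq_expect, Finset.expect_mul]
        simp [hF]
      rw [heq, if_pos hF]
      calc (1 : ℝ) = b (sp X) ^ m / 2 * (2 / b (sp X) ^ m) := by field_simp
        _ ≤ _ := mul_le_mul_of_nonneg_right h (by positivity)
    · simp [hF]
  have step2 : ∀ X Y, (if F (sp X) ∧ good Y (sp X) then 2 / b (sp X) ^ m else 0) ≤
      ∑ R ∈ Finset.powersetCard (N - m) Finset.univ,
        if ∀ j ∉ R, x (X j) ∈ sp' Y R (fun i => X i) then w Y R (fun i => X i) else 0 := by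
    intro X Y
    have hnn : ∀ R ∈ Finset.powersetCard (N - m) (Finset.univ : Finset (Fin N)), (0 : ℝ) ≤
        if ∀ j ∉ R, x (X j) ∈ sp' Y R (fun i => X i) then w Y R (fun i => X i) else 0 := by
      intro R _
      split_ifs
      · exact hw _ _ _
      · exact le_rfl
    split_ifs with h
    · obtain ⟨hF, hYW, hYi⟩ := h
      have hsup : Submodule.span K (Set.range (y ∘ Y)) ⊔ Submodule.span K (Set.range (x ∘ X)) =
          sp X := by
        refine sup_eq_right.2 (Submodule.span_le.2 ?_)
        rintro _ ⟨i, rfl⟩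
        exact hYW i
      have hfr : Module.finrank K (Submodule.span K (Set.range (y ∘ Y))) = m := by
        rw [finrank_span_eq_card hYi, Fintype.card_fin]
      obtain ⟨R, hR, hRe⟩ := exists_card_eq_sup_span_eq (K := K) (x ∘ X) (r := N - m)
        (by simp) (Submodule.span K (Set.range (y ∘ Y)))
        (by rw [hfr]; exact (Submodule.finrank_le _).trans (by omega))
      have hspR : sp' Y R (fun i => X i) = sp X := by
        rw [← hsup, ← hRe]
        simp only [sp']
        congr 2
        ext v
        simp
      refine le_trans ?_ (Finset.single_le_sum hnn
        (Finset.mem_powersetCard.2 ⟨Finset.subset_univ R, hR⟩))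
      rw [if_pos]
      · simp only [w]
        rw [hspR, if_pos hF]
      · intro j _
        rw [hspR]
        exact Submodule.subset_span ⟨j, rfl⟩
    · exact Finset.sum_nonneg hnn
  have step3 : ∀ Y, ∀ R ∈ Finset.powersetCard (N - m) (Finset.univ : Finset (Fin N)),
      (𝔼 X : Fin N → 𝒳,
        if ∀ j ∉ R, x (X j) ∈ sp' Y R (fun i => X i) then w Y R (fun i => X i) else 0) ≤
      2 * q ^ m := by
    intro Y R hR
    rw [Finset.mem_powersetCard] at hR
    rw [expect_ite_forall_notMem R (fun g ξ => x ξ ∈ sp' Y R g) (w Y R), Fintype.card_fin, hR.2,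
      Nat.sub_sub_self hm]
    refine (Finset.expect_le_expect (g := fun _ => 2 * q ^ m)
      fun g _ => ?_).trans_eq (Fintype.expect_const _)
    simp only [w]
    split_ifs with hF
    · have hb : 0 < b (sp' Y R g) := hpos _ hF
      have := pow_le_pow_left₀ (prob_nonneg _) (hq _ hF) m
      calc 2 / b (sp' Y R g) ^ m * prob (fun ξ => x ξ ∈ sp' Y R g) ^ m
          ≤ 2 / b (sp' Y R g) ^ m * (q * b (sp' Y R g)) ^ m :=
            mul_le_mul_of_nonneg_left this (by positivity)
        _ = 2 * q ^ m := by
            rw [mul_pow]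
            field_simp
    · rw [zero_mul]
      positivity
  calc prob (fun X => F (sp X))
      ≤ 𝔼 X, 𝔼 Y, if F (sp X) ∧ good Y (sp X) then 2 / b (sp X) ^ m else 0 := step1
    _ ≤ 𝔼 X : Fin N → 𝒳, 𝔼 Y, ∑ R ∈ Finset.powersetCard (N - m) Finset.univ,
        if ∀ j ∉ R, x (X j) ∈ sp' Y R (fun i => X i) then w Y R (fun i => X i) else 0 :=
      Finset.expect_le_expect fun X _ => Finset.expect_le_expect fun Y _ => step2 X Y
    _ = 𝔼 Y, ∑ R ∈ Finset.powersetCard (N - m) Finset.univ, 𝔼 X : Fin N → 𝒳,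
        if ∀ j ∉ R, x (X j) ∈ sp' Y R (fun i => X i) then w Y R (fun i => X i) else 0 := by
      rw [Finset.expect_comm]
      simp_rw [Finset.expect_sum_comm]
    _ ≤ 𝔼 _Y : Fin m → 𝒴, ∑ R ∈ Finset.powersetCard (N - m) (Finset.univ : Finset (Fin N)),
        2 * q ^ m := Finset.expect_le_expect fun Y _ => Finset.sum_le_sum (step3 Y)
    _ = 2 * N.choose m * q ^ m := by
      rw [Fintype.expect_const, Finset.sum_const, Finset.card_powersetCard, Finset.card_univ,
        Fintype.card_fin, Nat.choose_symm hm, nsmul_eq_mul]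
      ring

end Span

/-- The autocorrelation of the distribution of `g`. -/
noncomputable def autocorr {A G : Type*} [Fintype A] [AddCommGroup G] (g : A → G) (w : G) : ℝ :=
  prob fun p : A × A => g p.2 - g p.1 = w

section Shift

open scoped Pointwise

variable {G : Type*} [AddCommGroup G] {q : G → ℝ}

lemma summable_sub_shift_sq (hq : (Function.support q).Finite) (w : G) :
    Summable fun v => (q v - q (v + w)) ^ 2 := by
  have hs1 : Summable fun v => q v * q v := summable_of_hasFiniteSupport
    (hq.subset fun v hv => left_ne_zero_of_mul hv)
  have hs2 : Summable fun v => q (v + w) * q (v + w) :=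
    hs1.comp_injective (Equiv.addRight w).injective
  have hs3 : Summable fun v => q v * q (v + w) := summable_of_hasFiniteSupport
    (hq.subset fun v hv => left_ne_zero_of_mul hv)
  refine ((hs1.add hs2).sub (hs3.mul_left 2)).congr fun v => ?_
  ring

lemma tsum_sub_shift_sq (hq : (Function.support q).Finite) (w : G) :
    ∑' v, (q v - q (v + w)) ^ 2 = 2 * (∑' v, q v * q v - ∑' v, q v * q (v + w)) := by
  have hs1 : Summable fun v => q v * q v := summable_of_hasFiniteSupport
    (hq.subset fun v hv => left_ne_zero_of_mul hv)
  have hs2 : Summable fun v => q (v + w) * q (v + w) :=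
    hs1.comp_injective (Equiv.addRight w).injective
  have hs3 : Summable fun v => q v * q (v + w) := summable_of_hasFiniteSupport
    (hq.subset fun v hv => left_ne_zero_of_mul hv)
  have hexp : ∀ v, (q v - q (v + w)) ^ 2 = q v * q v + q (v + w) * q (v + w) -
      2 * (q v * q (v + w)) := fun v => by ring
  have hshift : ∑' v, q (v + w) * q (v + w) = ∑' v, q v * q v :=
    (Equiv.addRight w).tsum_eq fun v => q v * q v
  rw [tsum_congr hexp, (hs1.add hs2).tsum_sub (hs3.mul_left 2), hs1.tsum_add hs2, tsum_mul_left,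
    hshift]
  ring

lemma tsum_sub_shift_add_sq_le (hq : (Function.support q).Finite) (w w' : G) :
    ∑' v, (q v - q (v + (w + w'))) ^ 2 ≤
      2 * ∑' v, (q v - q (v + w)) ^ 2 + 2 * ∑' v, (q v - q (v + w')) ^ 2 := by
  have hs := (summable_sub_shift_sq hq w).mul_left 2
  have hs' : Summable fun v => 2 * (q (v + w) - q (v + w + w')) ^ 2 :=
    ((summable_sub_shift_sq hq w').comp_injective (Equiv.addRight w).injective).mul_left 2
  have hshift : ∑' v, (q (v + w) - q (v + w + w')) ^ 2 = ∑' v, (q v - q (v + w')) ^ 2 :=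
    (Equiv.addRight w).tsum_eq fun v => (q v - q (v + w')) ^ 2
  calc ∑' v, (q v - q (v + (w + w'))) ^ 2
      ≤ ∑' v, (2 * (q v - q (v + w)) ^ 2 + 2 * (q (v + w) - q (v + w + w')) ^ 2) := by
        refine (summable_sub_shift_sq hq (w + w')).tsum_le_tsum (fun v => ?_) (hs.add hs')
        rw [← add_assoc]
        generalize q (v + w + w') = c
        generalize q (v + w) = b
        generalize q v = a
        nlinarith [sq_nonneg (a - b - (b - c))]
    _ = _ := by rw [hs.tsum_add hs', tsum_mul_left, tsum_mul_left, hshift]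

end Shift

section Autocorr

open scoped Pointwise

variable {A B G : Type*} [Fintype A] [Fintype B]

lemma sum_prob_eq_eq (g : A → G) (S : Finset G) :
    ∑ v ∈ S, prob (fun a => g a = v) = prob fun a => g a ∈ S := by
  classical
  simp_rw [prob_eq_expect]
  rw [← Finset.expect_sum_comm]
  simp

lemma finite_support_prob_eq (g : A → G) :
    (Function.support fun v => prob fun a => g a = v).Finite := by
  classical
  refine (Set.finite_range g).subset fun v hv => ?_
  by_contra hne
  refine hv ?_
  have : ∀ a, g a ≠ v := fun a ha => hne ⟨a, ha⟩
  simp [prob_eq_expect, this]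

lemma tsum_prob_eq_mul (g : A → G) (f : G → ℝ) :
    ∑' v, prob (fun a => g a = v) * f v = 𝔼 a, f (g a) := by
  classical
  rw [tsum_eq_sum (s := Finset.univ.image g)]
  · simp_rw [prob_eq_expect, Finset.expect_mul]
    rw [← Finset.expect_sum_comm]
    refine Finset.expect_congr rfl fun a _ => ?_
    simp
  · intro v hv
    have : ∀ a, g a ≠ v := fun a ha => hv (Finset.mem_image.2 ⟨a, Finset.mem_univ a, ha⟩)
    simp [prob_eq_expect, this]

variable [AddCommGroup G]

lemma expect_prob_sub_eq (g : A → G) (u : B → G) (t : G) :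
    𝔼 a, prob (fun b => u b = t - g a) = prob fun p : A × B => g p.1 + u p.2 = t := by
  rw [prob_prod]
  simp_rw [eq_sub_iff_add_eq']

lemma autocorr_eq_expect (g : A → G) (w : G) :
    autocorr g w = 𝔼 a, prob (fun b => g b = g a + w) := by
  rw [autocorr, prob_prod]
  simp_rw [sub_eq_iff_eq_add']

lemma autocorr_eq_tsum (g : A → G) (w : G) :
    autocorr g w = ∑' v, prob (fun a => g a = v) * prob (fun a => g a = v + w) := by
  rw [tsum_prob_eq_mul g fun v => prob fun a => g a = v + w, autocorr_eq_expect]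

lemma autocorr_zero_pos [Nonempty A] (g : A → G) : 0 < autocorr g 0 := by
  classical
  rw [autocorr, prob_eq_card_div]
  have : 0 < (Finset.univ.filter fun p : A × A => g p.2 - g p.1 = 0).card :=
    Finset.card_pos.2 ⟨(Classical.arbitrary A, Classical.arbitrary A), by simp⟩
  have h : 0 < Fintype.card (A × A) := Fintype.card_pos
  positivity

lemma tsum_sub_shift_prob_sq (g : A → G) (w : G) :
    ∑' v, (prob (fun a => g a = v) - prob (fun a => g a = v + w)) ^ 2 =
      2 * (autocorr g 0 - autocorr g w) := by
  rw [tsum_sub_shift_sq (q := fun v => prob fun a => g a = v) (finite_support_prob_eq g),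
    autocorr_eq_tsum, autocorr_eq_tsum]
  simp_rw [add_zero]

lemma autocorr_le_zero (g : A → G) (w : G) : autocorr g w ≤ autocorr g 0 := by
  have h := tsum_sub_shift_prob_sq g w
  have : 0 ≤ ∑' v, (prob (fun a => g a = v) - prob (fun a => g a = v + w)) ^ 2 :=
    tsum_nonneg fun v => sq_nonneg _
  linarith

lemma autocorr_zero_sub_add_le (g : A → G) (w w' : G) :
    autocorr g 0 - autocorr g (w + w') ≤
      2 * (autocorr g 0 - autocorr g w) + 2 * (autocorr g 0 - autocorr g w') := by
  have h := tsum_sub_shift_add_sq_le (q := fun v => prob fun a => g a = v)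
    (finite_support_prob_eq g) w w'
  simp_rw [tsum_sub_shift_prob_sq] at h
  linarith

/-- The Cauchy–Schwarz bound for the point probabilities of a sum. -/
lemma prob_add_eq_le (u : A → G) (z : B → G) (t : G) :
    prob (fun p : A × B => u p.1 + z p.2 = t) ≤ (autocorr u 0 + autocorr z 0) / 2 := by
  set q : G → ℝ := fun v => prob (fun a => u a = v) with hq
  set r : G → ℝ := fun v => prob (fun b => z b = v) with hr
  have hs1 : Summable fun v => q v * q v := summable_of_hasFiniteSupport
    ((finite_support_prob_eq u).subset fun v hv => left_ne_zero_of_mul hv)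
  have hs2 : Summable fun v => r v * r v := summable_of_hasFiniteSupport
    ((finite_support_prob_eq z).subset fun v hv => left_ne_zero_of_mul hv)
  have hs2' : Summable fun v => r (t - v) * r (t - v) := (Equiv.subLeft t).summable_iff.2 hs2
  have hs3 : Summable fun v => q v * r (t - v) := summable_of_hasFiniteSupport
    ((finite_support_prob_eq u).subset fun v hv => left_ne_zero_of_mul hv)
  have h1 : autocorr u 0 = ∑' v, q v * q v := by
    rw [autocorr_eq_tsum]
    simp [hq]
  have h2 : autocorr z 0 = ∑' v, r (t - v) * r (t - v) := by
    rw [autocorr_eq_tsum]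
    simp_rw [add_zero]
    exact ((Equiv.subLeft t).tsum_eq fun v => r v * r v).symm
  have h3 : prob (fun p : A × B => u p.1 + z p.2 = t) = ∑' v, q v * r (t - v) := by
    rw [← expect_prob_sub_eq, tsum_prob_eq_mul u fun v => r (t - v)]
  have hle : ∑' v, 2 * (q v * r (t - v)) ≤ ∑' v, (q v * q v + r (t - v) * r (t - v)) := by
    refine (hs3.mul_left 2).tsum_le_tsum (fun v => ?_) (hs1.add hs2')
    nlinarith [sq_nonneg (q v - r (t - v))]
  rw [tsum_mul_left, hs1.tsum_add hs2', ← h1, ← h2, ← h3] at hle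
  linarith

lemma autocorr_add (u : A → G) (z : B → G) :
    autocorr (fun p : A × B => u p.1 + z p.2) 0 =
      𝔼 p : B × B, autocorr u (z p.1 - z p.2) := by
  have h : ∀ p : B × B, autocorr u (z p.1 - z p.2) =
      prob fun a : A × A => u a.2 - u a.1 = z p.1 - z p.2 := fun p => rfl
  simp_rw [h]
  rw [← prob_prod fun p : (B × B) × (A × A) => u p.2.2 - u p.2.1 = z p.1.1 - z p.1.2, autocorr,
    ← prob_equiv ((Equiv.prodProdProdComm A B A B).trans (Equiv.prodComm _ _))]
  congr! 2 with p
  simp only [Equiv.trans_apply, Equiv.prodProdProdComm_apply, Equiv.prodComm_apply,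
    Prod.swap_prod_mk]
  rw [sub_eq_zero, sub_eq_sub_iff_add_eq_add]
  constructor <;> intro h <;> rw [add_comm (z _)] at * <;> simpa [add_comm] using h

lemma autocorr_add_comm (u : A → G) (z : B → G) :
    autocorr (fun p : A × B => u p.1 + z p.2) 0 = autocorr (fun p : B × A => z p.1 + u p.2) 0 := by
  rw [autocorr, autocorr,
    ← prob_equiv (Equiv.prodCongr (Equiv.prodComm A B) (Equiv.prodComm A B))]
  congr! 2 with p
  simp [add_comm]

lemma autocorr_add_le_left [Nonempty B] (u : A → G) (z : B → G) :
    autocorr (fun p : A × B => u p.1 + z p.2) 0 ≤ autocorr u 0 := by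
  rw [autocorr_add]
  exact (Finset.expect_le_expect fun p _ => autocorr_le_zero u _).trans_eq (Fintype.expect_const _)

/-- In a torsion-free group, adding an independent summand to a nondegenerate random variable
decreases the collision probability by a constant factor. -/
lemma autocorr_add_le_mul [IsAddTorsionFree G] [Nonempty A] [Nonempty B] (u : A → G) (z : B → G)
    (hzu : autocorr z 0 ≤ autocorr u 0) (hu : autocorr u 0 ≤ 1 / 2) :
    autocorr (fun p : A × B => u p.1 + z p.2) 0 ≤ 399 / 400 * autocorr u 0 := by
  classical
  by_contra! hcon
  rw [autocorr_add] at hcon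
  set c := autocorr u 0 with hc
  have hc0 : 0 < c := autocorr_zero_pos u
  have hlevel : ∀ η : ℝ, η < 1 → ∃ S : Finset G, ∀ w, w ∈ S ↔ (1 - η) * c ≤ autocorr u w := by
    intro η hη
    have hfin : {w | (1 - η) * c ≤ autocorr u w}.Finite := by
      refine (finite_support_prob_eq fun p : A × A => u p.2 - u p.1).subset fun w hw => ?_
      have : 0 < (1 - η) * c := mul_pos (by linarith) hc0
      exact (this.trans_le hw).ne'
    exact ⟨hfin.toFinset, fun w => by simp⟩
  obtain ⟨D, hD⟩ := hlevel (1 / 20) (by norm_num)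
  obtain ⟨D', hD'⟩ := hlevel (1 / 5) (by norm_num)
  have hzero : (0 : G) ∈ D := by
    rw [hD]
    change _ ≤ c
    linarith
  have hmass : 19 / 20 ≤ prob fun p : B × B => z p.1 - z p.2 ∈ D := by
    have hle : (𝔼 p : B × B, autocorr u (z p.1 - z p.2)) ≤
        19 / 20 * c + 1 / 20 * c * prob fun p : B × B => z p.1 - z p.2 ∈ D := by
      rw [prob_eq_expect, Finset.mul_expect,
        ← Fintype.expect_const (ι := B × B) (19 / 20 * c), ← Finset.expect_add_distrib]
      refine Finset.expect_le_expect fun p _ => ?_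
      split_ifs with h
      · have := autocorr_le_zero u (z p.1 - z p.2)
        linarith
      · rw [hD] at h
        linarith
    nlinarith
  have hDcard : 19 / 20 ≤ D.card * c := by
    refine hmass.trans ?_
    have hswap : (prob fun p : B × B => z p.1 - z p.2 ∈ D) =
        prob fun p : B × B => z p.2 - z p.1 ∈ D := by
      rw [← prob_equiv (Equiv.prodComm B B)]
      rfl
    rw [hswap, ← sum_prob_eq_eq (fun p : B × B => z p.2 - z p.1), ← nsmul_eq_mul]
    exact Finset.sum_le_card_nsmul _ _ _ fun w _ => (autocorr_le_zero z w).trans hzu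
  have hsub : D + D ⊆ D' := by
    intro w hw
    obtain ⟨a, ha, b, hb, rfl⟩ := Finset.mem_add.1 hw
    rw [hD] at ha hb
    rw [hD']
    have := autocorr_zero_sub_add_le u a b
    linarith
  have hCD : 2 * (D.card : ℝ) - 1 ≤ D'.card := by
    have h1 := cauchy_davenport_of_isAddTorsionFree ⟨0, hzero⟩ ⟨0, hzero⟩
    have h2 := h1.trans (Finset.card_le_card hsub)
    have h3 : 2 * D.card ≤ D'.card + 1 := by omega
    have h4 : (2 * D.card : ℝ) ≤ D'.card + 1 := by exact_mod_cast h3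
    linarith
  have hD'card : D'.card * (4 / 5 * c) ≤ 1 := by
    refine le_trans ?_ (prob_le_one fun p : A × A => u p.2 - u p.1 ∈ D')
    rw [← sum_prob_eq_eq (fun p : A × A => u p.2 - u p.1), ← nsmul_eq_mul]
    refine Finset.card_nsmul_le_sum _ _ _ fun w hw => ?_
    rw [hD'] at hw
    change _ ≤ autocorr u w
    linarith
  nlinarith

lemma autocorr_add_le_add [IsAddTorsionFree G] [Nonempty A] [Nonempty B] (u : A → G) (z : B → G)
    (hu : autocorr u 0 ≤ 1 / 2) (hz : autocorr z 0 ≤ 1 / 2) :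
    autocorr (fun p : A × B => u p.1 + z p.2) 0 ≤
      799 / 800 * ((autocorr u 0 + autocorr z 0) / 2) := by
  have h1 := autocorr_add_le_left u z
  have h2 := autocorr_add_le_left z u
  rw [autocorr_add_comm] at h2
  rcases le_total (autocorr z 0) (autocorr u 0) with h | h
  · have := autocorr_add_le_mul u z h hu
    linarith
  · have := autocorr_add_le_mul z u h hz
    rw [autocorr_add_comm] at this
    linarith

lemma prob_add_add_eq_le [IsAddTorsionFree G] [Nonempty A] (g : Fin 4 → A → G) (t : G)
    (hg : ∀ i, autocorr (g i) 0 ≤ 1 / 2) :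
    prob (fun p : (A × A) × (A × A) =>
      (g 0 p.1.1 + g 1 p.1.2) + (g 2 p.2.1 + g 3 p.2.2) = t) ≤
      799 / 800 * 𝔼 i, autocorr (g i) 0 := by
  have h := prob_add_eq_le (fun p : A × A => g 0 p.1 + g 1 p.2)
    (fun p : A × A => g 2 p.1 + g 3 p.2) t
  have h1 := autocorr_add_le_add (g 0) (g 1) (hg 0) (hg 1)
  have h2 := autocorr_add_le_add (g 2) (g 3) (hg 2) (hg 3)
  rw [Fintype.expect_eq_sum_div_card, Fin.sum_univ_four, Fintype.card_fin]
  push_cast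
  linarith

end Autocorr

section Perm

variable {V : Type*} [Fintype V] [DecidableEq V]

lemma card_perm_comp_eq_le {I : Type*} [Fintype I] (p : I ↪ V) (φ : I → V) :
    (Finset.univ.filter fun σ : Equiv.Perm V => ∀ i, σ (p i) = φ i).card ≤
      (Fintype.card V - Fintype.card I).factorial := by
  classical
  rcases (Finset.univ.filter fun σ : Equiv.Perm V => ∀ i, σ (p i) = φ i).eq_empty_or_nonempty
    with h | ⟨σ₀, h₀⟩
  · simp [h]
  have hσ₀ : ∀ i, σ₀ (p i) = φ i := by simpa using h₀
  have hc : Fintype.card {x // x ∉ Set.range p} = Fintype.card V - Fintype.card I := by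
    rw [Fintype.card_subtype_compl, ← Fintype.card_congr (Equiv.ofInjective p p.injective)]
  rw [← hc, ← Fintype.card_perm,
    Fintype.card_congr (Equiv.Perm.subtypeEquivSubtypePerm fun x => x ∉ Set.range p),
    Fintype.card_subtype]
  refine Finset.card_le_card_of_injOn (fun σ => σ₀⁻¹ * σ) (fun σ hσ => ?_)
    (fun σ _ τ _ h => mul_left_cancel h)
  have hσ' : ∀ i, σ (p i) = φ i := by simpa using hσ
  simp [hσ', ← hσ₀]

lemma expect_perm_comp_le {I : Type*} [Fintype I] [DecidableEq I] (p : I ↪ V)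
    (hI : Fintype.card I < Fintype.card V) (F : (I → V) → ℝ) (hF : ∀ φ, 0 ≤ F φ) :
    𝔼 σ : Equiv.Perm V, F (fun i => σ (p i)) ≤
      (∑ φ, F φ) / ((Fintype.card V : ℝ) - Fintype.card I) ^ Fintype.card I := by
  classical
  set n := Fintype.card V
  set m := Fintype.card I
  have hsum : ∑ σ : Equiv.Perm V, F (fun i => σ (p i)) ≤ (n - m).factorial * ∑ φ, F φ := by
    rw [← Finset.sum_fiberwise Finset.univ (fun σ : Equiv.Perm V => fun i => σ (p i)),
      Finset.mul_sum]
    refine Finset.sum_le_sum fun φ _ => ?_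
    rw [Finset.sum_congr rfl (g := fun _ => F φ)
      (fun σ hσ => by rw [(Finset.mem_filter.1 hσ).2]), Finset.sum_const, nsmul_eq_mul]
    refine mul_le_mul_of_nonneg_right ?_ (hF φ)
    have := card_perm_comp_eq_le p φ
    simp_rw [← funext_iff (f := fun i => _ )] at this
    exact_mod_cast this
  have hnm : (0 : ℝ) < (n : ℝ) - m := sub_pos.2 (by exact_mod_cast hI)
  have hpow : ((n : ℝ) - m) ^ m * (n - m).factorial ≤ n.factorial := by
    rw [← Nat.cast_sub hI.le, ← Nat.factorial_mul_descFactorial hI.le, mul_comm]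
    push_cast
    refine mul_le_mul_of_nonneg_left ?_ (by positivity)
    have : (n - m) ^ m ≤ n.descFactorial m :=
      (Nat.pow_le_pow_left (by omega) m).trans (Nat.pow_sub_le_descFactorial n m)
    exact_mod_cast this
  rw [Fintype.expect_eq_sum_div_card, Fintype.card_perm]
  have hS : 0 ≤ ∑ φ, F φ := Finset.sum_nonneg fun φ _ => hF φ
  rw [div_le_div_iff₀ (by positivity) (by positivity)]
  calc _ ≤ ((n - m).factorial * ∑ φ, F φ) * ((n : ℝ) - m) ^ m := by gcongr
    _ = (∑ φ, F φ) * (((n : ℝ) - m) ^ m * (n - m).factorial) := by ring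
    _ ≤ _ := by gcongr

lemma expect_perm_prod_le {J : Type*} [Fintype J] [DecidableEq J] [Nonempty V]
    (p : J × Bool ↪ V)
    (h : V → V → ℝ) (hh : ∀ x y, 0 ≤ h x y) {γ : ℝ} (hγ1 : γ ≤ 1)
    (hsum : ∑ x, ∑ y, h x y ≤ (1 - γ) * (Fintype.card V : ℝ) ^ 2)
    (hJ : 2 * (Fintype.card J : ℝ) ≤ γ / 4 * Fintype.card V) :
    𝔼 σ : Equiv.Perm V, ∏ j, h (σ (p (j, false))) (σ (p (j, true))) ≤
      (1 - γ / 2) ^ Fintype.card J := by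
  have hV : (0 : ℝ) < Fintype.card V := by exact_mod_cast Fintype.card_pos
  have hcI : Fintype.card (J × Bool) = 2 * Fintype.card J := by
    rw [Fintype.card_prod, Fintype.card_bool, mul_comm]
  have hlt : Fintype.card (J × Bool) < Fintype.card V := by
    rw [hcI]
    have : 2 * (Fintype.card J : ℝ) < Fintype.card V := by nlinarith
    exact_mod_cast this
  refine (expect_perm_comp_le p hlt (fun φ => ∏ j, h (φ (j, false)) (φ (j, true)))
    fun φ => Finset.prod_nonneg fun _ _ => hh _ _).trans ?_
  have hφ : ∑ φ : J × Bool → V, ∏ j, h (φ (j, false)) (φ (j, true)) =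
      (∑ x, ∑ y, h x y) ^ Fintype.card J := by
    rw [← Finset.card_univ, ← Finset.prod_const, ← Fintype.sum_prod_type', Finset.prod_univ_sum,
      Fintype.piFinset_univ]
    refine Fintype.sum_equiv ((Equiv.curry J Bool V).trans
      (Equiv.piCongrRight fun _ => Equiv.boolArrowEquivProd V)) _ _ fun φ => ?_
    rfl
  rw [hφ, hcI, pow_mul, ← div_pow]
  push_cast
  set n : ℝ := ((Fintype.card V : ℕ) : ℝ)
  have h1 : (1 - γ / 4) * n ≤ n - 2 * Fintype.card J := by linarith
  have h2 : ((1 - γ / 4) * n) ^ 2 ≤ (n - 2 * Fintype.card J) ^ 2 :=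
    pow_le_pow_left₀ (mul_nonneg (by linarith) hV.le) h1 2
  refine pow_le_pow_left₀ (div_nonneg (Finset.sum_nonneg fun x _ => Finset.sum_nonneg
    fun y _ => hh x y) (by positivity)) ?_ _
  rw [div_le_iff₀ (lt_of_lt_of_le (pow_pos (mul_pos (by linarith) hV) 2) h2)]
  refine hsum.trans (le_trans ?_ (mul_le_mul_of_nonneg_left h2 (by linarith)))
  rw [mul_pow, ← mul_assoc]
  refine mul_le_mul_of_nonneg_right ?_ (by positivity)
  nlinarith [sq_nonneg γ, mul_nonneg (sq_nonneg γ) (sub_nonneg.2 hγ1)]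

lemma exists_perm_map_eq {s t : Finset V} (h : s.card = t.card) :
    ∃ τ : Equiv.Perm V, s.map τ.toEmbedding = t := by
  have e : {x // x ∈ s} ≃ {x // x ∈ t} := Finset.equivOfCardEq h
  refine ⟨e.extendSubtype, Finset.eq_of_subset_of_card_le ?_ (by simp [h])⟩
  intro x hx
  obtain ⟨y, hy, rfl⟩ := Finset.mem_map.1 hx
  exact e.extendSubtype_mem y hy

lemma expect_perm_map_eq {k : ℕ} (g : Finset V → ℝ) {s : Finset V} (hs : s.card = k) :
    𝔼 σ : Equiv.Perm V, g (s.map σ.toEmbedding) =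
      𝔼 t : {t : Finset V // t.card = k}, g t := by
  have key : ∀ t : {t : Finset V // t.card = k},
      𝔼 σ : Equiv.Perm V, g (t.1.map σ.toEmbedding) =
        𝔼 σ : Equiv.Perm V, g (s.map σ.toEmbedding) := by
    intro t
    obtain ⟨τ, hτ⟩ := exists_perm_map_eq (hs.trans t.2.symm)
    refine Fintype.expect_equiv (Equiv.mulRight τ) _ _ fun σ => ?_
    rw [← hτ, Finset.map_map]
    rfl
  have : Nonempty {t : Finset V // t.card = k} := ⟨⟨s, hs⟩⟩
  rw [← Fintype.expect_const (ι := {t : Finset V // t.card = k})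
    (𝔼 σ : Equiv.Perm V, g (s.map σ.toEmbedding)),
    ← Finset.expect_congr rfl fun t _ => key t, Finset.expect_comm]
  refine (Finset.expect_congr rfl fun σ _ => ?_).trans (Fintype.expect_const _)
  exact Fintype.expect_equiv ((Equiv.finsetCongr σ).subtypeEquiv fun t => by simp) _ _
    fun t => by simp

end Perm

section PairSum

variable {V J : Type*} [DecidableEq V] [Fintype J]

/-- The indicator vector of the set that picks, from each pair `(p (j, false), p (j, true))`,
the point selected by `a j`. -/
def pairSum (p : J × Bool → V) (a : J → Bool) : V → ℝ := ∑ j, Pi.single (p (j, a j)) 1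

lemma pairSum_sub (p : J × Bool → V) (a b : J → Bool) :
    pairSum p b - pairSum p a =
      ∑ j, (Pi.single (p (j, b j)) 1 - Pi.single (p (j, a j)) 1 : V → ℝ) :=
  (Finset.sum_sub_distrib _ _).symm

lemma pairSum_apply {p : J × Bool → V} (hp : p.Injective) (a : J → Bool) (j : J) (b : Bool) :
    pairSum p a (p (j, b)) = if a j = b then 1 else 0 := by
  rw [pairSum, Finset.sum_apply, Finset.sum_eq_single j]
  · simp [Pi.single_apply, hp.eq_iff, eq_comm]
  · intro k _ hk
    simp [hp.eq_iff, hk.symm]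
  · simp

variable [DecidableEq J]

/-- The probability that the difference of two independent uniformly random choices of
`pairSum p` lies in `W`. -/
noncomputable def pairSubProb (W : Submodule ℝ (V → ℝ)) (p : J × Bool → V) : ℝ :=
  prob fun q : (J → Bool) × (J → Bool) => pairSum p q.2 - pairSum p q.1 ∈ W

lemma autocorr_mkQ_pairSum (W : Submodule ℝ (V → ℝ)) (p : J × Bool → V) :
    autocorr (fun a => W.mkQ (pairSum p a)) 0 = pairSubProb W p := by
  unfold autocorr pairSubProb
  congr 1
  ext q
  rw [← map_sub, Submodule.mkQ_apply, Submodule.Quotient.mk_eq_zero]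

lemma prob_pairSum_le_half_pow (W : Submodule ℝ (V → ℝ)) (p : J × Bool → V) (S : Finset J)
    (hS : ∀ a b : J → Bool, (∀ j ∉ S, a j = b j) → pairSum p b - pairSum p a ∈ W → a = b) :
    pairSubProb W p ≤ (1 / 2) ^ S.card := by
  classical
  rw [pairSubProb, prob_prod]
  refine (Finset.expect_le_expect (g := fun _ => (1 / 2 : ℝ) ^ S.card)
    fun a _ => ?_).trans_eq (Fintype.expect_const _)
  have hinj : (Finset.univ.filter fun b => pairSum p b - pairSum p a ∈ W).card ≤
      (Finset.univ : Finset ({j // j ∉ S} → Bool)).card := by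
    refine Finset.card_le_card_of_injOn (fun b j => b j) (fun _ _ => by simp) ?_
    intro b hb c hc hbc
    refine hS b c (fun j hj => congrFun hbc ⟨j, hj⟩) ?_
    have := W.sub_mem (Finset.mem_filter.1 hc).2 (Finset.mem_filter.1 hb).2
    simpa using this
  rw [Finset.card_univ, Fintype.card_fun, Fintype.card_bool, Fintype.card_subtype_compl,
    Fintype.card_coe] at hinj
  rw [prob_eq_card_div, Fintype.card_fun, Fintype.card_bool, one_div, inv_pow,
    div_le_iff₀ (by positivity), inv_mul_eq_div, le_div_iff₀ (by positivity)]
  calc _ ≤ (2 : ℝ) ^ (Fintype.card J - S.card) * 2 ^ S.card := by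
        gcongr
        exact_mod_cast hinj
    _ = 2 ^ Fintype.card J := by
        rw [← pow_add, Nat.sub_add_cancel S.card_le_univ]
    _ = _ := by norm_cast

lemma pairSubProb_le_half (W : Submodule ℝ (V → ℝ)) (p : J × Bool → V) (j : J)
    (hj : (Pi.single (p (j, false)) 1 - Pi.single (p (j, true)) 1 : V → ℝ) ∉ W) :
    pairSubProb W p ≤ 1 / 2 := by
  have := prob_pairSum_le_half_pow W p {j} fun a b hab hW => by
    have hoff : ∀ k ≠ j, a k = b k := fun k hk => hab k (by simpa using hk)
    rw [pairSum_sub, Finset.sum_eq_single j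
      (fun k _ hk => by rw [hoff k hk, sub_self]) (by simp)] at hW
    have hjj : a j = b j := by
      cases ha : a j <;> cases hb : b j <;> rw [ha, hb] at hW
      · exact absurd (by simpa using W.neg_mem hW) hj
      · exact absurd hW hj
    ext k
    by_cases hk : k = j
    · rw [hk, hjj]
    · rw [hoff k hk]
  simpa using this

variable [Fintype V]

lemma exists_finset_forall_eq_zero (W : Submodule ℝ (V → ℝ)) :
    ∃ T : Finset V, Fintype.card V ≤ T.card + Module.finrank ℝ W ∧
      ∀ v ∈ W, (∀ x ∉ T, v x = 0) → v = 0 := by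
  classical
  set e : V → (V → ℝ) ⧸ W := fun x => W.mkQ (Pi.single x 1)
  obtain ⟨κ, a, ha, hspan, hli⟩ := exists_linearIndependent' ℝ e
  have : Fintype κ := Fintype.ofInjective a ha
  have htop : Submodule.span ℝ (Set.range e) = ⊤ := by
    have h : Set.range e = W.mkQ '' Set.range fun x : V => (Pi.single x 1 : V → ℝ) := by
      rw [← Set.range_comp]
      rfl
    have hb : Submodule.span ℝ (Set.range fun x : V => (Pi.single x 1 : V → ℝ)) = ⊤ := by
      convert (Pi.basisFun ℝ V).span_eq using 3
      ext x
      simp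
    rw [h, Submodule.span_image, hb, Submodule.map_top, Submodule.range_mkQ]
  have hcard : Module.finrank ℝ ((V → ℝ) ⧸ W) ≤ Fintype.card κ := by
    rw [← finrank_top, ← htop, ← hspan]
    exact finrank_range_le_card _
  refine ⟨Finset.univ.map ⟨a, ha⟩, ?_, fun v hv hv0 => ?_⟩
  · have := W.finrank_quotient_add_finrank
    rw [Module.finrank_fintype_fun_eq_card] at this
    rw [Finset.card_map, Finset.card_univ]
    omega
  · have hv' : ∑ k, v (a k) • e (a k) = 0 := by
      have h1 : ∑ x, v x • e x = 0 := by
        have : W.mkQ v = ∑ x, v x • e x := by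
          conv_lhs => rw [← Finset.univ_sum_single v, map_sum]
          refine Finset.sum_congr rfl fun x _ => ?_
          rw [← map_smul, ← Pi.single_smul, smul_eq_mul, mul_one]
        rw [← this, Submodule.mkQ_apply, Submodule.Quotient.mk_eq_zero]
        exact hv
      rw [← h1]
      refine (Finset.sum_map Finset.univ ⟨a, ha⟩ fun x => v x • e x).symm.trans ?_
      refine Finset.sum_subset (Finset.subset_univ _) fun x _ hx => ?_
      rw [hv0 x hx, zero_smul]
    have hz := Fintype.linearIndependent_iff.1 hli (fun k => v (a k)) hv'
    ext x
    by_cases hx : x ∈ Finset.univ.map ⟨a, ha⟩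
    · obtain ⟨k, -, rfl⟩ := Finset.mem_map.1 hx
      exact hz k
    · exact hv0 x hx

lemma expect_pairSubProb_le [Nonempty V] (W : Submodule ℝ (V → ℝ)) (p : J × Bool ↪ V) {β γ : ℝ}
    (hβ0 : 0 ≤ β) (hγ1 : γ ≤ 1) (hβ : γ ≤ β ^ 2 / 2)
    (hJ : 2 * (Fintype.card J : ℝ) ≤ γ / 4 * Fintype.card V)
    (hW : (Module.finrank ℝ W : ℝ) ≤ (1 - β) * Fintype.card V) :
    𝔼 σ : Equiv.Perm V, pairSubProb W (fun q => σ (p q)) ≤ (1 - γ / 2) ^ Fintype.card J := by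
  classical
  obtain ⟨T, hT, hTz⟩ := exists_finset_forall_eq_zero W
  set h : V → V → ℝ := fun x y => if x ∈ T ∧ y ∈ T then 1 / 2 else 1
  refine le_trans ?_ (expect_perm_prod_le p h (fun x y => by positivity) hγ1 ?_ hJ)
  · refine Finset.expect_le_expect fun σ _ => ?_
    set S : Finset J := Finset.univ.filter fun j => σ (p (j, false)) ∈ T ∧ σ (p (j, true)) ∈ T
    have hpow : ∏ j, h (σ (p (j, false))) (σ (p (j, true))) = (1 / 2) ^ S.card := by
      rw [Finset.prod_ite, Finset.prod_const, Finset.prod_const_one, mul_one]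
    rw [hpow]
    refine prob_pairSum_le_half_pow W _ S fun a b hab hmem => ?_
    have hinj : Function.Injective fun q => σ (p q) := σ.injective.comp p.injective
    have hz := hTz _ hmem fun x hx => by
      rw [pairSum_sub, Finset.sum_apply]
      refine Finset.sum_eq_zero fun j _ => ?_
      by_cases hj : j ∈ S
      · have hj' := (Finset.mem_filter.1 hj).2
        have hb : ∀ b, σ (p (j, b)) ∈ T := by simpa using hj'
        have hne : ∀ b, x ≠ σ (p (j, b)) := fun b hxb => hx (hxb ▸ hb b)
        rw [Pi.sub_apply, Pi.single_eq_of_ne (hne _), Pi.single_eq_of_ne (hne _), sub_zero]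
      · rw [hab j hj, sub_self, Pi.zero_apply]
    ext j : 1
    have := congrFun hz (σ (p (j, b j)))
    rw [Pi.sub_apply, Pi.zero_apply, pairSum_apply hinj b j (b j),
      pairSum_apply hinj a j (b j)] at this
    by_contra hne
    simp [hne] at this
  · have h1 : ∀ x y, h x y = 1 - 1 / 2 * ((if x ∈ T then 1 else 0) * if y ∈ T then 1 else 0) := by
      intro x y
      by_cases hx : x ∈ T <;> by_cases hy : y ∈ T <;> norm_num [h, hx, hy]
    have h2 : ∑ x, ∑ y, h x y = (Fintype.card V : ℝ) ^ 2 - 1 / 2 * (T.card : ℝ) ^ 2 := by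
      simp_rw [h1, Finset.sum_sub_distrib, ← Finset.mul_sum, ← Finset.sum_mul]
      simp
      ring
    have hT' : β * Fintype.card V ≤ T.card := by
      have : (Fintype.card V : ℝ) ≤ T.card + Module.finrank ℝ W := by exact_mod_cast hT
      linarith
    have h3 : (β * Fintype.card V) ^ 2 ≤ (T.card : ℝ) ^ 2 := by gcongr
    rw [h2]
    nlinarith [mul_le_mul_of_nonneg_right hβ (sq_nonneg (Fintype.card V : ℝ))]

lemma prob_forall_single_sub_mem_le [Nonempty V] (W : Submodule ℝ (V → ℝ)) (p : J × Bool ↪ V)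
    {γ : ℝ} (hγ1 : γ ≤ 1)
    (hJ : 2 * (Fintype.card J : ℝ) ≤ γ / 4 * Fintype.card V)
    (hW : ∀ T : Finset V, (∀ x ∈ T, ∀ y ∈ T, (Pi.single x 1 - Pi.single y 1 : V → ℝ) ∈ W) →
      (T.card : ℝ) ≤ (1 - γ) * Fintype.card V) :
    prob (fun σ : Equiv.Perm V => ∀ j,
      (Pi.single (σ (p (j, false))) 1 - Pi.single (σ (p (j, true))) 1 : V → ℝ) ∈ W) ≤
      (1 - γ / 2) ^ Fintype.card J := by
  classical
  set h : V → V → ℝ := fun x y => if (Pi.single x 1 - Pi.single y 1 : V → ℝ) ∈ W then 1 else 0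
  have hprob : prob (fun σ : Equiv.Perm V => ∀ j,
      (Pi.single (σ (p (j, false))) 1 - Pi.single (σ (p (j, true))) 1 : V → ℝ) ∈ W) =
      𝔼 σ : Equiv.Perm V, ∏ j, h (σ (p (j, false))) (σ (p (j, true))) := by
    rw [prob_eq_expect]
    refine Finset.expect_congr rfl fun σ _ => ?_
    simp only [h]
    rw [Fintype.prod_boole]
  rw [hprob]
  refine expect_perm_prod_le p h (fun x y => by positivity) hγ1 ?_ hJ
  have hx : ∀ x, ∑ y, h x y ≤ (1 - γ) * Fintype.card V := by
    intro x
    rw [Finset.sum_boole]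
    refine hW _ fun y hy z hz => ?_
    have := W.sub_mem (Finset.mem_filter.1 hz).2 (Finset.mem_filter.1 hy).2
    simpa using this
  calc ∑ x, ∑ y, h x y ≤ ∑ _x : V, (1 - γ) * (Fintype.card V : ℝ) :=
        Finset.sum_le_sum fun x _ => hx x
    _ = _ := by simp; ring_nf

end PairSum

section Compare

variable {V : Type*} [DecidableEq V]

/-- The indicator vector of a finite set. -/
def indVec (s : Finset V) : V → ℝ := fun x => if x ∈ s then 1 else 0

lemma indVec_eq_sum (s : Finset V) : indVec s = ∑ x ∈ s, Pi.single x 1 := by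
  ext y
  simp [indVec, Finset.sum_apply, Pi.single_apply]

/-- The block with index `i` of a family of disjoint pairs. -/
def pairBlock {I J : Type*} (p : (I × J) × Bool ↪ V) (i : I) : J × Bool ↪ V :=
  ⟨fun q => p ((i, q.1), q.2), fun q r h => by simpa [Prod.ext_iff] using p.injective h⟩

lemma indVec_map_union {I : Type*} [Fintype I] [DecidableEq I] (p : I × Bool ↪ V) (B : Finset V)
    (hB : ∀ q, p q ∉ B) (c : I → Bool) (σ : Equiv.Perm V) :
    indVec ((B ∪ Finset.univ.image fun i => p (i, c i)).map σ.toEmbedding) =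
      indVec (B.map σ.toEmbedding) + ∑ i, Pi.single (σ (p (i, c i))) 1 := by
  have hdisj : Disjoint B (Finset.univ.image fun i => p (i, c i)) := by
    rw [Finset.disjoint_right]
    intro x hx
    obtain ⟨i, -, rfl⟩ := Finset.mem_image.1 hx
    exact hB _
  rw [indVec_eq_sum, indVec_eq_sum, Finset.sum_map, Finset.sum_map, Finset.sum_union hdisj,
    Finset.sum_image fun i _ j _ h => congrArg Prod.fst (p.injective h)]
  rfl

lemma card_union_image {I : Type*} [Fintype I] [DecidableEq I] (p : I × Bool ↪ V) (B : Finset V)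
    (hB : ∀ q, p q ∉ B) (c : I → Bool) :
    (B ∪ Finset.univ.image fun i => p (i, c i)).card = B.card + Fintype.card I := by
  rw [Finset.card_union_of_disjoint, Finset.card_image_of_injective, Finset.card_univ]
  · exact fun i j h => congrArg Prod.fst (p.injective h)
  · rw [Finset.disjoint_right]
    intro x hx
    obtain ⟨i, -, rfl⟩ := Finset.mem_image.1 hx
    exact hB _

variable [Fintype V] {J : Type*} [Fintype J] [DecidableEq J]

/-- The difference of two selections from a random block of pairs in random position. -/
def pairDiff {I : Type*} (p : (I × J) × Bool ↪ V)
    (y : I × Equiv.Perm V × (J → Bool) × (J → Bool)) : V → ℝ :=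
  pairSum (fun q => y.2.1 (pairBlock p y.1 q)) y.2.2.2 -
    pairSum (fun q => y.2.1 (pairBlock p y.1 q)) y.2.2.1

lemma prob_pairDiff_mem {I : Type*} [Fintype I] (W : Submodule ℝ (V → ℝ))
    (p : (I × J) × Bool ↪ V) :
    prob (fun y => pairDiff p y ∈ W) =
      𝔼 i, 𝔼 σ : Equiv.Perm V, pairSubProb W (fun q => σ (pairBlock p i q)) := by
  rw [prob_prod]
  refine Finset.expect_congr rfl fun i _ => ?_
  rw [prob_prod]
  rfl

lemma prob_pairDiff_mem_le {I : Type*} [Fintype I] [Nonempty I] [Nonempty V]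
    (W : Submodule ℝ (V → ℝ)) (p : (I × J) × Bool ↪ V) {β γ : ℝ}
    (hβ0 : 0 ≤ β) (hγ1 : γ ≤ 1) (hβ : γ ≤ β ^ 2 / 2)
    (hJ : 2 * (Fintype.card J : ℝ) ≤ γ / 4 * Fintype.card V)
    (hW : (Module.finrank ℝ W : ℝ) ≤ (1 - β) * Fintype.card V) :
    prob (fun y => pairDiff p y ∈ W) ≤ (1 - γ / 2) ^ Fintype.card J := by
  rw [prob_pairDiff_mem]
  refine (Finset.expect_le_expect fun i _ => ?_).trans_eq (Fintype.expect_const _)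
  exact expect_pairSubProb_le W _ hβ0 hγ1 hβ hJ hW

lemma prob_indVec_mem_eq {I Ω : Type*} [Fintype I] [DecidableEq I] [Fintype Ω] [Nonempty Ω]
    (W : Submodule ℝ (V → ℝ)) (p : I × Bool ↪ V) (B : Finset V) (hB : ∀ q, p q ∉ B)
    (c : Ω → I → Bool) :
    prob (fun s : {s : Finset V // s.card = B.card + Fintype.card I} => indVec s.1 ∈ W) =
      𝔼 σ : Equiv.Perm V, prob fun ω =>
        indVec (B.map σ.toEmbedding) + ∑ i, Pi.single (σ (p (i, c ω i))) 1 ∈ W := by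
  classical
  simp_rw [prob_eq_expect]
  rw [Finset.expect_comm, ← Fintype.expect_const (ι := Ω) (𝔼 s : {s : Finset V // _}, _)]
  refine Finset.expect_congr rfl fun ω _ => ?_
  rw [← expect_perm_map_eq (fun s => if indVec s ∈ W then (1 : ℝ) else 0)
    (card_union_image p B hB (c ω))]
  simp_rw [indVec_map_union p B hB]

lemma prob_indVec_mem_le [Nonempty V] (W : Submodule ℝ (V → ℝ)) (p : (Fin 4 × J) × Bool ↪ V)
    (B : Finset V) (hB : ∀ q, p q ∉ B) {k : ℕ} (hk : B.card + Fintype.card (Fin 4 × J) = k)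
    {γ : ℝ} (hγ1 : γ ≤ 1)
    (hJ : 2 * (Fintype.card J : ℝ) ≤ γ / 4 * Fintype.card V)
    (hW : ∀ T : Finset V, (∀ x ∈ T, ∀ y ∈ T, (Pi.single x 1 - Pi.single y 1 : V → ℝ) ∈ W) →
      (T.card : ℝ) ≤ (1 - γ) * Fintype.card V) :
    prob (fun s : {s : Finset V // s.card = k} => indVec s.1 ∈ W) ≤
      799 / 800 * prob (fun y => pairDiff p y ∈ W) + 4 * (1 - γ / 2) ^ Fintype.card J := by
  classical
  subst hk
  have : IsAddTorsionFree ((V → ℝ) ⧸ W) := .of_isTorsionFree ℝ _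
  rw [prob_indVec_mem_eq W p B hB
    fun (ω : ((J → Bool) × (J → Bool)) × ((J → Bool) × (J → Bool))) (q : Fin 4 × J) =>
      (![ω.1.1, ω.1.2, ω.2.1, ω.2.2] q.1) q.2]
  set bad : Fin 4 → Equiv.Perm V → Prop := fun i σ => ∀ j,
    (Pi.single (σ (pairBlock p i (j, false))) 1 - Pi.single (σ (pairBlock p i (j, true))) 1 :
      V → ℝ) ∈ W
  have hnn : ∀ i σ, (0 : ℝ) ≤ if bad i σ then 1 else 0 := fun i σ => by positivity
  have key : ∀ σ : Equiv.Perm V,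
      prob (fun ω : ((J → Bool) × (J → Bool)) × ((J → Bool) × (J → Bool)) =>
        indVec (B.map σ.toEmbedding) + ∑ q : Fin 4 × J,
          Pi.single (σ (p (q, (![ω.1.1, ω.1.2, ω.2.1, ω.2.2] q.1) q.2))) 1 ∈ W) ≤
      799 / 800 * 𝔼 i, pairSubProb W (fun q => σ (pairBlock p i q)) +
        ∑ i, if bad i σ then 1 else 0 := by
    intro σ
    have hE : 0 ≤ 𝔼 i : Fin 4, pairSubProb W (fun q => σ (pairBlock p i q)) :=
      Finset.expect_nonneg fun i _ => prob_nonneg _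
    by_cases hbad : ∃ i, bad i σ
    · obtain ⟨i, hi⟩ := hbad
      have h1 := Finset.single_le_sum (fun j _ => hnn j σ) (Finset.mem_univ i)
      rw [if_pos hi] at h1
      have h2 := prob_le_one (fun ω : ((J → Bool) × (J → Bool)) × ((J → Bool) × (J → Bool)) =>
        indVec (B.map σ.toEmbedding) + ∑ q : Fin 4 × J,
          Pi.single (σ (p (q, (![ω.1.1, ω.1.2, ω.2.1, ω.2.2] q.1) q.2))) 1 ∈ W)
      linarith
    · have hac : ∀ i, autocorr
          (fun a => W.mkQ (pairSum (fun q => σ (pairBlock p i q)) a)) 0 ≤ 1 / 2 := by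
        intro i
        rw [autocorr_mkQ_pairSum]
        obtain ⟨j, hj⟩ := not_forall.1 (not_exists.1 hbad i)
        exact pairSubProb_le_half W _ j hj
      have h := prob_add_add_eq_le
        (fun i a => W.mkQ (pairSum (fun q => σ (pairBlock p i q)) a))
        (-W.mkQ (indVec (B.map σ.toEmbedding))) hac
      simp_rw [autocorr_mkQ_pairSum] at h
      refine le_trans (le_of_eq ?_) (h.trans
        (le_add_of_nonneg_right (Finset.sum_nonneg fun i _ => hnn i σ)))
      congr 1
      ext ω
      rw [eq_neg_iff_add_eq_zero, ← map_add, ← map_add, ← map_add, ← map_add,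
        Submodule.mkQ_apply, Submodule.Quotient.mk_eq_zero, add_comm, Fintype.sum_prod_type,
        Fin.sum_univ_four, ← add_assoc]
      rfl
  refine (Finset.expect_le_expect fun σ _ => key σ).trans ?_
  rw [Finset.expect_add_distrib, ← Finset.mul_expect, Finset.expect_comm, ← prob_pairDiff_mem,
    Finset.expect_sum_comm]
  refine add_le_add_right ?_ _
  have hb : ∀ i, 𝔼 σ, (if bad i σ then (1 : ℝ) else 0) ≤ (1 - γ / 2) ^ Fintype.card J := by
    intro i
    rw [← prob_eq_expect]
    exact prob_forall_single_sub_mem_le W (pairBlock p i) hγ1 hJ hW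
  refine (Finset.sum_le_sum fun i _ => hb i).trans_eq ?_
  simp

lemma exists_pairs_disjoint {ℓ k : ℕ} (h1 : 4 * ℓ ≤ k) (h2 : k + 4 * ℓ ≤ Fintype.card V) :
    ∃ (p : (Fin 4 × Fin ℓ) × Bool ↪ V) (B : Finset V), (∀ q, p q ∉ B) ∧
      B.card + Fintype.card (Fin 4 × Fin ℓ) = k := by
  have hc : Fintype.card ((Fin 4 × Fin ℓ) × Bool) = 8 * ℓ := by simp; ring_nf
  obtain ⟨p⟩ : Nonempty ((Fin 4 × Fin ℓ) × Bool ↪ V) :=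
    Function.Embedding.nonempty_of_card_le (by omega)
  obtain ⟨B, hB, hBc⟩ := Finset.exists_subset_card_eq
    (s := (Finset.univ.map p)ᶜ) (n := k - 4 * ℓ) (by
      rw [Finset.card_compl, Finset.card_map, Finset.card_univ, hc]
      omega)
  refine ⟨p, B, fun q hq => ?_, ?_⟩
  · exact Finset.mem_compl.1 (hB hq) (Finset.mem_map_of_mem p (Finset.mem_univ q))
  · simp only [Fintype.card_prod, Fintype.card_fin]
    omega

end Compare

section Degenerate

lemma exists_single_sub_notMem {V : Type*} [Fintype V] [DecidableEq V] {W : Submodule ℝ (V → ℝ)}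
    (hW : W ≠ ⊤) {s : Finset V} (hs : s.Nonempty) (hsW : indVec s ∈ W) :
    ∃ u v, (Pi.single u 1 - Pi.single v 1 : V → ℝ) ∉ W := by
  by_contra! h
  refine hW (eq_top_iff.2 ?_)
  rw [← (Pi.basisFun ℝ V).span_eq, Submodule.span_le]
  rintro _ ⟨u, rfl⟩
  rw [Pi.basisFun_apply]
  have h1 : (s.card : ℝ) • (Pi.single u 1 : V → ℝ) ∈ W := by
    have h2 := W.add_mem hsW (W.sum_mem fun v (_ : v ∈ s) => h u v)
    rw [indVec_eq_sum, ← Finset.sum_add_distrib] at h2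
    simpa [Nat.cast_smul_eq_nsmul] using h2
  have hc : (s.card : ℝ) ≠ 0 := by exact_mod_cast hs.card_ne_zero
  exact (W.smul_mem_iff hc).1 h1

lemma choose_le_card_notMem {V : Type*} [Fintype V] [DecidableEq V] {W : Submodule ℝ (V → ℝ)}
    {u v : V} (huv : (Pi.single u 1 - Pi.single v 1 : V → ℝ) ∉ W) (k : ℕ)
    [DecidablePred fun s : {s : Finset V // s.card = k + 1} => indVec s.1 ∉ W] :
    (Fintype.card V - 2).choose k ≤
      (Finset.univ.filter fun s : {s : Finset V // s.card = k + 1} => indVec s.1 ∉ W).card := by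
  classical
  have hne : u ≠ v := by
    rintro rfl
    simp at huv
  have hcard : ({u, v}ᶜ : Finset V).card = Fintype.card V - 2 := by
    rw [Finset.card_compl, Finset.card_pair hne]
  rw [← hcard, ← Finset.card_powersetCard]
  have hmem : ∀ r ∈ Finset.powersetCard k ({u, v}ᶜ : Finset V), r.card = k ∧ u ∉ r ∧ v ∉ r := by
    intro r hr
    rw [Finset.mem_powersetCard] at hr
    exact ⟨hr.2, fun h => by simpa using hr.1 h, fun h => by simpa using hr.1 h⟩
  set F : Finset V → Finset V := fun r =>
    if indVec (insert u r) ∈ W then insert v r else insert u r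
  have hF : ∀ r ∈ Finset.powersetCard k ({u, v}ᶜ : Finset V), (F r).card = k + 1 ∧
      indVec (F r) ∉ W ∧ ((F r).erase u).erase v = r := by
    intro r hr
    obtain ⟨hk, hu, hv⟩ := hmem r hr
    simp only [F]
    split_ifs with h
    · refine ⟨by rw [Finset.card_insert_of_notMem hv, hk], fun h' => huv ?_, ?_⟩
      · have := W.sub_mem h h'
        rwa [indVec_eq_sum, indVec_eq_sum, Finset.sum_insert hu, Finset.sum_insert hv,
          add_sub_add_right_eq_sub] at this
      · ext x
        by_cases hxu : x = u <;> by_cases hxv : x = v <;> simp_all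
    · refine ⟨by rw [Finset.card_insert_of_notMem hu, hk], h, ?_⟩
      ext x
      by_cases hxu : x = u <;> by_cases hxv : x = v <;> simp_all
  rw [← Finset.card_map (Function.Embedding.subtype fun s : Finset V => s.card = k + 1)]
  refine Finset.card_le_card_of_injOn F (fun r hr => ?_) fun r hr t ht h => ?_
  · have := hF r hr
    simp [this.1, this.2.1]
  · rw [← (hF r hr).2.2, ← (hF t ht).2.2]
    simp only [h]

lemma choose_sub_two_mul {n k : ℕ} (hk : k + 2 ≤ n) :
    (n - 2).choose k * (n * (n - 1)) = n.choose (k + 1) * ((k + 1) * (n - (k + 1))) := by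
  obtain ⟨m, rfl⟩ := Nat.exists_eq_add_of_le' (le_trans (Nat.le_add_left 2 k) hk)
  have h1 := Nat.choose_mul_succ_eq m k
  have h2 := Nat.add_one_mul_choose_eq (m + 1) k
  have h3 : m + 2 - (k + 1) = m + 1 - k := by omega
  rw [h3, Nat.add_sub_cancel]
  show m.choose k * ((m + 2) * (m + 1)) = _
  calc m.choose k * ((m + 2) * (m + 1)) = (m + 2) * (m.choose k * (m + 1)) := by ring
    _ = ((m + 1 + 1) * (m + 1).choose k) * (m + 1 - k) := by rw [h1]; ring
    _ = _ := by rw [h2]; ring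

lemma prob_indVec_mem_le_one_sub_sq {V : Type*} [Fintype V] [DecidableEq V] {c : ℝ} {k : ℕ}
    (hc0 : 0 < c) (hV : 0 < Fintype.card V) (hk : c * Fintype.card V ≤ k)
    (hk' : c * Fintype.card V ≤ (Fintype.card V : ℝ) - k)
    {W : Submodule ℝ (V → ℝ)} (hW : W ≠ ⊤) :
    prob (fun s : {s : Finset V // s.card = k} => indVec s.1 ∈ W) ≤ 1 - c ^ 2 := by
  classical
  have hn : (0 : ℝ) < Fintype.card V := by exact_mod_cast hV
  have hcn : 0 < c * Fintype.card V := mul_pos hc0 hn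
  have hkpos : 0 < k := by exact_mod_cast hcn.trans_le hk
  have hkn : k < Fintype.card V := by
    have : (k : ℝ) < Fintype.card V := by linarith
    exact_mod_cast this
  have hne : Nonempty {s : Finset V // s.card = k} := by
    obtain ⟨s, -, hs⟩ := Finset.exists_subset_card_eq
      (show k ≤ (Finset.univ : Finset V).card from hkn.le)
    exact ⟨⟨s, hs⟩⟩
  have hcard : Fintype.card {s : Finset V // s.card = k} = (Fintype.card V).choose k :=
    Fintype.card_finset_len k
  by_cases huv : ∃ u v, (Pi.single u 1 - Pi.single v 1 : V → ℝ) ∉ W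
  · obtain ⟨u, v, huv⟩ := huv
    rw [← sub_sub_self 1 (prob _), ← prob_not, prob_eq_card_div, hcard]
    refine sub_le_sub_left ?_ 1
    have hch : (0 : ℝ) < (Fintype.card V).choose k := by exact_mod_cast Nat.choose_pos hkn.le
    rw [le_div_iff₀ hch]
    obtain ⟨l, rfl⟩ := Nat.exists_eq_succ_of_ne_zero hkpos.ne'
    refine le_trans ?_ (Nat.cast_le.2 (choose_le_card_notMem huv l))
    have h := choose_sub_two_mul (n := Fintype.card V) (k := l) (by omega)
    have hr : ((Fintype.card V - 2).choose l : ℝ) *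
        (Fintype.card V * ((Fintype.card V : ℝ) - 1)) =
        (Fintype.card V).choose (l + 1) * (((l + 1 : ℕ) : ℝ) *
          ((Fintype.card V : ℝ) - (l + 1 : ℕ))) := by
      rw [← Nat.cast_sub hkn.le, ← Nat.cast_one, ← Nat.cast_sub hV]
      exact_mod_cast h
    set n : ℝ := ((Fintype.card V : ℕ) : ℝ)
    have hprod : (c * n) * (c * n) ≤ ((l + 1 : ℕ) : ℝ) * (n - (l + 1 : ℕ)) :=
      mul_le_mul hk hk' hcn.le (Nat.cast_nonneg _)
    have hb : (0 : ℝ) ≤ ((Fintype.card V - 2).choose l : ℝ) := Nat.cast_nonneg _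
    refine le_of_mul_le_mul_right ?_ (mul_pos hn hn)
    calc c ^ 2 * ((Fintype.card V).choose (l + 1)) * (n * n)
        = (Fintype.card V).choose (l + 1) * ((c * n) * (c * n)) := by ring
      _ ≤ (Fintype.card V).choose (l + 1) * (((l + 1 : ℕ) : ℝ) * (n - (l + 1 : ℕ))) := by gcongr
      _ = _ := hr.symm
      _ ≤ _ := by
        gcongr
        linarith
  · have h0 : prob (fun s : {s : Finset V // s.card = k} => indVec s.1 ∈ W) = 0 :=
      prob_eq_zero fun s hs => huv (exists_single_sub_notMem hW
        (Finset.card_pos.1 (s.2.symm ▸ hkpos)) hs)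
    have hc : c * Fintype.card V ≤ 1 * Fintype.card V := by linarith
    have hc1 : c ≤ 1 := le_of_mul_le_mul_right hc hn
    rw [h0]
    nlinarith

lemma card_le_finrank_add_one {V : Type*} [Fintype V] [DecidableEq V] (T : Finset V)
    {D : Submodule ℝ (V → ℝ)}
    (hD : ∀ x ∈ T, ∀ y ∈ T, (Pi.single x 1 - Pi.single y 1 : V → ℝ) ∈ D) :
    T.card ≤ Module.finrank ℝ D + 1 := by
  classical
  rcases T.eq_empty_or_nonempty with rfl | ⟨x₀, hx₀⟩
  · simp
  set S : Finset (V → ℝ) := (insert x₀ Tᶜ).image fun x => Pi.single x 1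
  have htop : D ⊔ Submodule.span ℝ (S : Set (V → ℝ)) = ⊤ := by
    rw [eq_top_iff, ← (Pi.basisFun ℝ V).span_eq, Submodule.span_le]
    rintro _ ⟨x, rfl⟩
    rw [Pi.basisFun_apply]
    have hS : ∀ y ∈ insert x₀ Tᶜ, (Pi.single y 1 : V → ℝ) ∈
        D ⊔ Submodule.span ℝ (S : Set (V → ℝ)) := fun y hy =>
      Submodule.mem_sup_right (Submodule.subset_span (Finset.mem_coe.2
        (Finset.mem_image_of_mem _ hy)))
    by_cases hx : x ∈ T
    · have := Submodule.add_mem _ (Submodule.mem_sup_left (hD x hx x₀ hx₀))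
        (hS x₀ (Finset.mem_insert_self _ _))
      simpa using this
    · exact hS x (by simp [hx])
  have h1 := Submodule.finrank_add_le_finrank_add_finrank D
    (Submodule.span ℝ (S : Set (V → ℝ)))
  rw [htop, finrank_top, Module.finrank_fintype_fun_eq_card] at h1
  have h2 := finrank_span_finset_le_card (R := ℝ) S
  have h3 : S.card ≤ Tᶜ.card + 1 := Finset.card_image_le.trans (Finset.card_insert_le _ _)
  rw [Set.finrank] at h2
  have h4 := Finset.card_add_card_compl T
  omega

variable {α : Type*} [Fintype α] [Nonempty α] {N : ℕ}

lemma prob_small_le (hN : 0 < N) (x : α → Fin N → ℝ) {τ : ℝ} (hτ : 0 ≤ τ) :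
    prob (fun f : Fin N → α => Submodule.span ℝ (Set.range (x ∘ f)) ≠ ⊤ ∧
      prob (fun a => x a ∈ Submodule.span ℝ (Set.range (x ∘ f))) ≤ τ) ≤ N * τ := by
  classical
  set S : (R : Finset (Fin N)) → (R → α) → α → Prop := fun R g a =>
    x a ∈ Submodule.span ℝ (Set.range (x ∘ g)) ∧
      prob (fun b => x b ∈ Submodule.span ℝ (Set.range (x ∘ g))) ≤ τ
  have hS : ∀ R g, prob (S R g) ≤ τ := by
    intro R g
    by_cases h : prob (fun b => x b ∈ Submodule.span ℝ (Set.range (x ∘ g))) ≤ τ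
    · exact (prob_mono fun a ha => ha.1).trans h
    · refine le_trans (le_of_eq ?_) hτ
      exact prob_eq_zero fun a ha => h ha.2
  refine (prob_mono (q := fun f : Fin N → α => ∃ R ∈ Finset.powersetCard (N - 1) Finset.univ,
    ∀ j ∉ R, S R (fun i => f i) (f j)) ?_).trans ((prob_exists_le _ _).trans ?_)
  · rintro f ⟨hne, hle⟩
    have hlt : Module.finrank ℝ (Submodule.span ℝ (Set.range (x ∘ f))) < N := by
      have := Submodule.finrank_lt hne
      rwa [Module.finrank_fin_fun] at this
    obtain ⟨R, hR, hspan⟩ := exists_card_eq_sup_span_eq (x ∘ f) (r := N - 1) (by simp)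
      (⊥ : Submodule ℝ (Fin N → ℝ)) (by rw [bot_sup_eq, finrank_bot]; omega)
    rw [bot_sup_eq, bot_sup_eq] at hspan
    refine ⟨R, Finset.mem_powersetCard.2 ⟨Finset.subset_univ _, hR⟩, fun j _ => ?_⟩
    have hrange : Set.range (x ∘ fun i : R => f i) = (x ∘ f) '' R := by
      ext v
      simp
    simp only [S]
    rw [hrange, hspan]
    exact ⟨Submodule.subset_span ⟨j, rfl⟩, hle⟩
  · refine (Finset.sum_le_sum fun R hR =>
      prob_forall_notMem_le R (S R) fun g => hS R g).trans_eq ?_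
    rw [Finset.sum_congr rfl (g := fun _ => τ) fun R hR => by
      rw [(Finset.mem_powersetCard.1 hR).2, Fintype.card_fin, Nat.sub_sub_self hN, pow_one]]
    rw [Finset.sum_const, Finset.card_powersetCard, Finset.card_univ, Fintype.card_fin,
      Nat.choose_symm hN, Nat.choose_one_right, nsmul_eq_mul]

/-- `W` contains all differences of the standard basis vectors outside a set of `s` indices. -/
def ContainsDifferences (s : ℕ) (W : Submodule ℝ (Fin N → ℝ)) : Prop :=
  ∃ T : Finset (Fin N), T.card = N - s ∧ ∀ u ∈ T, ∀ v ∈ T,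
    (Pi.single u 1 - Pi.single v 1 : Fin N → ℝ) ∈ W

lemma prob_containsDifferences_le (x : α → Fin N → ℝ) {θ : ℝ} (hθ : 0 ≤ θ)
    (hx : ∀ W : Submodule ℝ (Fin N → ℝ), W ≠ ⊤ → prob (fun a => x a ∈ W) ≤ θ)
    {s : ℕ} (hs : s ≤ N) :
    prob (fun f : Fin N → α => Submodule.span ℝ (Set.range (x ∘ f)) ≠ ⊤ ∧
      ContainsDifferences s (Submodule.span ℝ (Set.range (x ∘ f)))) ≤
      (N.choose s : ℝ) ^ 2 * θ ^ (N - s) := by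
  classical
  set D : Finset (Fin N) → Submodule ℝ (Fin N → ℝ) := fun T =>
    Submodule.span ℝ {w | ∃ u ∈ T, ∃ v ∈ T, w = Pi.single u 1 - Pi.single v 1}
  set S : (T R : Finset (Fin N)) → (R → α) → α → Prop := fun T R g a =>
    D T ⊔ Submodule.span ℝ (Set.range (x ∘ g)) ≠ ⊤ ∧
      x a ∈ D T ⊔ Submodule.span ℝ (Set.range (x ∘ g))
  have hS : ∀ T R g, prob (S T R g) ≤ θ := by
    intro T R g
    by_cases h : D T ⊔ Submodule.span ℝ (Set.range (x ∘ g)) = ⊤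
    · refine le_trans (le_of_eq ?_) hθ
      exact prob_eq_zero fun a ha => ha.1 h
    · exact (prob_mono fun a ha => ha.2).trans (hx _ h)
  refine (prob_mono (q := fun f : Fin N → α =>
    ∃ P ∈ Finset.powersetCard (N - s) Finset.univ ×ˢ Finset.powersetCard s Finset.univ,
    ∀ j ∉ P.2, S P.1 P.2 (fun i => f i) (f j)) ?_).trans ((prob_exists_le _ _).trans ?_)
  · rintro f ⟨hne, T, hT, hTW⟩
    set W := Submodule.span ℝ (Set.range (x ∘ f))
    have hlt : Module.finrank ℝ W < N := by
      have := Submodule.finrank_lt hne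
      rwa [Module.finrank_fin_fun] at this
    have hDW : D T ≤ W := by
      rw [Submodule.span_le]
      rintro _ ⟨u, hu, v, hv, rfl⟩
      exact hTW u hu v hv
    have hDT := card_le_finrank_add_one T (D := D T) fun u hu v hv =>
      Submodule.subset_span ⟨u, hu, v, hv, rfl⟩
    obtain ⟨R, hR, hspan⟩ := exists_card_eq_sup_span_eq (x ∘ f) (r := s) (by simpa using hs)
      (D T) (by rw [sup_eq_right.2 hDW]; omega)
    rw [sup_eq_right.2 hDW] at hspan
    refine ⟨(T, R), Finset.mem_product.2 ⟨Finset.mem_powersetCard.2 ⟨Finset.subset_univ _, hT⟩,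
      Finset.mem_powersetCard.2 ⟨Finset.subset_univ _, hR⟩⟩, fun j _ => ?_⟩
    have hrange : Set.range (x ∘ fun i : R => f i) = (x ∘ f) '' R := by
      ext v
      simp
    simp only [S]
    rw [hrange, hspan]
    exact ⟨hne, Submodule.subset_span ⟨j, rfl⟩⟩
  · refine (Finset.sum_le_sum fun P hP => prob_forall_notMem_le P.2 (S P.1 P.2)
      fun g => hS P.1 P.2 g).trans_eq ?_
    rw [Finset.sum_congr rfl (g := fun _ => θ ^ (N - s)) fun P hP => by
      rw [(Finset.mem_powersetCard.1 (Finset.mem_product.1 hP).2).2, Fintype.card_fin]]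
    rw [Finset.sum_const, Finset.card_product, Finset.card_powersetCard,
      Finset.card_powersetCard, Finset.card_univ, Fintype.card_fin, Nat.choose_symm hs,
      nsmul_eq_mul]
    push_cast
    ring

end Degenerate

section Numeric

lemma choose_mul_pow_le_one_add_pow {x : ℝ} (hx : 0 ≤ x) (n k : ℕ) :
    (n.choose k : ℝ) * x ^ k ≤ (1 + x) ^ n := by
  rcases lt_or_ge n k with h | h
  · rw [Nat.choose_eq_zero_of_lt h, Nat.cast_zero, zero_mul]
    positivity
  rw [add_comm, add_pow]
  refine le_trans (le_of_eq ?_) (Finset.single_le_sum (f := fun m => x ^ m * 1 ^ (n - m) *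
    (n.choose m : ℝ)) (fun m _ => by positivity) (Finset.mem_range.2 (Nat.lt_succ_of_le h)))
  rw [one_pow]
  ring

lemma exists_choose_sq_mul_pow_le {q : ℝ} (hq0 : 0 < q) (hq1 : q < 1) :
    ∃ β : ℝ, 0 < β ∧ β < 1 ∧ ∃ θ : ℝ, 0 < θ ∧ θ < 1 ∧ ∀ n k : ℕ, (k : ℝ) ≤ β * n →
      (n.choose k : ℝ) ^ 2 * q ^ (n - k) ≤ θ ^ n := by
  set x : ℝ := (1 - q) / 4 with hx
  have hx0 : 0 < x := by linarith
  have hx1 : x < 1 := by linarith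
  set y : ℝ := (1 + x) ^ 2 * q
  have hy0 : 0 < y := by positivity
  have hy1 : y < 1 := by
    have hq : q = 1 - 4 * x := by linarith
    simp only [y]
    rw [hq]
    nlinarith [mul_pos hx0 hx0, mul_pos hx0 (mul_pos hx0 hx0)]
  set M : ℝ := (x ^ 2 * q)⁻¹ with hM
  have hxq : x ^ 2 * q ≤ 1 := mul_le_one₀ (pow_le_one₀ hx0.le hx1.le) hq0.le hq1.le
  have hM1 : 1 ≤ M := (one_le_inv₀ (by positivity)).2 hxq
  have hM0 : 0 < M := one_pos.trans_le hM1
  have hcont : Filter.Tendsto (fun β : ℝ => M ^ β) (nhdsWithin 0 (Set.Ioi 0)) (nhds 1) := by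
    have : Continuous fun β : ℝ => M ^ β := Real.continuous_const_rpow hM0.ne'
    simpa using (this.tendsto 0).mono_left nhdsWithin_le_nhds
  obtain ⟨β, hβM, hβ0, hβ1⟩ := ((hcont.eventually_lt_const ((one_lt_inv₀ hy0).2 hy1)).and
    (Ioo_mem_nhdsGT (zero_lt_one' ℝ))).exists
  refine ⟨β, hβ0, hβ1, y * M ^ β, by positivity, ?_, fun n k hk => ?_⟩
  · calc y * M ^ β < y * y⁻¹ := by gcongr
      _ = 1 := mul_inv_cancel₀ hy0.ne'
  · have hkn : k ≤ n := by
      have : (k : ℝ) ≤ n := hk.trans (mul_le_of_le_one_left (Nat.cast_nonneg _) hβ1.le)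
      exact_mod_cast this
    have h1 := choose_mul_pow_le_one_add_pow hx0.le n k
    have h2 : ((n.choose k : ℝ) * x ^ k) ^ 2 ≤ ((1 + x) ^ n) ^ 2 := by gcongr
    have h3 : M ^ k ≤ (M ^ β) ^ n := by
      rw [← Real.rpow_natCast, ← Real.rpow_natCast, ← Real.rpow_mul hM0.le]
      exact Real.rpow_le_rpow_of_exponent_le hM1 hk
    have hxk : (x ^ 2 * q) ^ k * M ^ k = 1 := by
      rw [← mul_pow, hM, mul_inv_cancel₀ (by positivity), one_pow]
    calc (n.choose k : ℝ) ^ 2 * q ^ (n - k)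
        = (n.choose k : ℝ) ^ 2 * q ^ (n - k) * ((x ^ 2 * q) ^ k * M ^ k) := by
          rw [hxk, mul_one]
      _ = ((n.choose k : ℝ) * x ^ k) ^ 2 * (q ^ (n - k) * q ^ k) * M ^ k := by ring_nf
      _ = ((n.choose k : ℝ) * x ^ k) ^ 2 * q ^ n * M ^ k := by
          rw [← pow_add, Nat.sub_add_cancel hkn]
      _ ≤ ((1 + x) ^ n) ^ 2 * q ^ n * (M ^ β) ^ n := by gcongr
      _ = (y * M ^ β) ^ n := by
          rw [mul_pow, mul_pow, ← pow_mul, ← pow_mul, mul_comm 2 n]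

lemma eventually_mul_add_one_mul_pow_le (C : ℝ) {b : ℝ} (hb0 : 0 < b) (hb1 : b < 1) :
    ∀ᶠ n : ℕ in Filter.atTop, C * (n + 1) * b ^ n ≤ 1 := by
  have h1 := tendsto_self_mul_const_pow_of_lt_one hb0.le hb1
  have h2 := tendsto_pow_atTop_nhds_zero_of_lt_one hb0.le hb1
  have h3 := (h1.add h2).const_mul C
  rw [add_zero, mul_zero] at h3
  filter_upwards [h3.eventually_le_const one_pos] with n hn
  linarith

lemma pow_floor_le {a η : ℝ} (ha : 1 / 2 ≤ a) (ha1 : a ≤ 1) (n : ℕ) :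
    a ^ ⌊η * n⌋₊ ≤ 2 * (a ^ η) ^ n := by
  have ha0 : 0 < a := by linarith
  have h : a ^ (⌊η * n⌋₊ + 1) ≤ (a ^ η) ^ n := by
    rw [← Real.rpow_natCast, ← Real.rpow_natCast, ← Real.rpow_mul ha0.le]
    exact Real.rpow_le_rpow_of_exponent_ge ha0 ha1
      (by exact_mod_cast (Nat.lt_floor_add_one (η * n)).le)
  rw [pow_succ] at h
  have := mul_le_mul_of_nonneg_left ha (pow_nonneg ha0.le ⌊η * n⌋₊)
  linarith

lemma exists_eventually_add_pow_le {b₁ b₂ b₃ : ℝ} (h₁ : 0 < b₁) (h₂ : 0 < b₂) (h₃ : 0 < b₃)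
    (h₁' : b₁ < 1) (h₂' : b₂ < 1) (h₃' : b₃ < 1) :
    ∃ θ : ℝ, 0 < θ ∧ θ < 1 ∧
      ∀ᶠ n : ℕ in Filter.atTop, n * b₁ ^ n + b₂ ^ n + 2 * b₃ ^ n ≤ θ ^ n := by
  set b := max b₁ (max b₂ b₃)
  have hb0 : 0 < b := h₁.trans_le (le_max_left _ _)
  have hb1 : b < 1 := max_lt h₁' (max_lt h₂' h₃')
  have hs0 : 0 < √b := Real.sqrt_pos.2 hb0
  have hs1 : √b < 1 := (Real.sqrt_lt' one_pos).2 (by simpa using hb1)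
  refine ⟨√b, hs0, hs1, ?_⟩
  filter_upwards [eventually_mul_add_one_mul_pow_le 3 hs0 hs1] with n hn
  have e₁ : b₁ ^ n ≤ b ^ n := by gcongr; exact le_max_left _ _
  have e₂ : b₂ ^ n ≤ b ^ n := by gcongr; exact (le_max_left _ _).trans (le_max_right _ _)
  have e₃ : b₃ ^ n ≤ b ^ n := by gcongr; exact (le_max_right _ _).trans (le_max_right _ _)
  have hbs : b ^ n = √b ^ n * √b ^ n := by rw [← mul_pow, Real.mul_self_sqrt hb0.le]
  have hbn : 0 < b ^ n := pow_pos hb0 n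
  calc n * b₁ ^ n + b₂ ^ n + 2 * b₃ ^ n ≤ n * b ^ n + b ^ n + 2 * b ^ n := by gcongr
    _ ≤ 3 * (n + 1) * b ^ n := by nlinarith [mul_nonneg (Nat.cast_nonneg (α := ℝ) n) hbn.le]
    _ = √b ^ n * (3 * (n + 1) * √b ^ n) := by rw [hbs]; ring
    _ ≤ √b ^ n * 1 := by gcongr
    _ = √b ^ n := mul_one _

end Numeric

section Main

lemma pairDiff_mem_prob_pos {V I J : Type*} [Fintype V] [DecidableEq V] [Fintype J]
    [DecidableEq J] [Fintype I] [Nonempty I] (W : Submodule ℝ (V → ℝ))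
    (p : (I × J) × Bool ↪ V) :
    0 < prob fun y => pairDiff p y ∈ W := by
  rw [prob_pairDiff_mem]
  refine Finset.expect_pos (fun i _ => Finset.expect_pos (fun σ _ => ?_) Finset.univ_nonempty)
    Finset.univ_nonempty
  rw [← autocorr_mkQ_pairSum]
  exact autocorr_zero_pos _

/-- Random vectors of weight `k` rarely span a proper subspace that is neither sparse nor of
small probability. -/
lemma prob_span_indVec_nondegenerate_le {N k ℓ s m : ℕ} {β γ τ : ℝ} (hN : 0 < N)
    (hℓ1 : 4 * ℓ ≤ k) (hℓ2 : k + 4 * ℓ ≤ N) (hβ0 : 0 ≤ β) (hγ1 : γ ≤ 1)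
    (hβγ : γ ≤ β ^ 2 / 2) (hℓ : 2 * (ℓ : ℝ) ≤ γ / 4 * N) (hs : γ * N ≤ s + 1) (hsN : s ≤ N)
    (hm : m ≤ N) (hmβ : (m : ℝ) ≤ (1 - β) * N + 1) (hτ0 : 0 ≤ τ)
    (hτ1 : 6400 * (1 - γ / 2) ^ ℓ ≤ τ) (hτ2 : 2 * m * (1 - γ / 2) ^ ℓ ≤ τ) :
    prob (fun f : Fin N → {s : Finset (Fin N) // s.card = k} =>
      ¬ ContainsDifferences s (Submodule.span ℝ (Set.range ((fun t => indVec t.1) ∘ f))) ∧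
      τ < prob fun t : {s : Finset (Fin N) // s.card = k} =>
        indVec t.1 ∈ Submodule.span ℝ (Set.range ((fun t => indVec t.1) ∘ f))) ≤
      2 * N.choose m * (1 - 1 / 1600) ^ m := by
  have : Nonempty (Fin N) := ⟨⟨0, hN⟩⟩
  obtain ⟨p, B, hB, hk⟩ := exists_pairs_disjoint (V := Fin N) hℓ1 (by simpa using hℓ2)
  have : Nonempty {s : Finset (Fin N) // s.card = k} := by
    obtain ⟨t, -, ht⟩ := Finset.exists_subset_card_eq
      (show k ≤ (Finset.univ : Finset (Fin N)).card by
        rw [Finset.card_univ, Fintype.card_fin]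
        omega)
    exact ⟨⟨t, ht⟩⟩
  have hJ : 2 * (Fintype.card (Fin ℓ) : ℝ) ≤ γ / 4 * Fintype.card (Fin N) := by
    simpa using hℓ
  have hr : (0 : ℝ) ≤ (1 - γ / 2) ^ ℓ := pow_nonneg (by linarith) _
  have hcomp : ∀ W : Submodule ℝ (Fin N → ℝ),
      ¬ ContainsDifferences s W →
      (τ < prob fun t : {s : Finset (Fin N) // s.card = k} => indVec t.1 ∈ W) →
      (prob fun t : {s : Finset (Fin N) // s.card = k} => indVec t.1 ∈ W) ≤
        (1 - 1 / 1600) * prob fun y => pairDiff p y ∈ W := by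
    intro W hsp hlarge
    have h := prob_indVec_mem_le W p B hB hk hγ1 hJ fun T hT => by
      have hlt : T.card < N - s := by
        by_contra! hge
        obtain ⟨T', hT'T, hT'⟩ := Finset.exists_subset_card_eq hge
        exact hsp ⟨T', hT', fun u hu v hv => hT u (hT'T hu) v (hT'T hv)⟩
      have hlt' : (T.card : ℝ) + 1 + s ≤ N := by
        exact_mod_cast (by omega : T.card + 1 + s ≤ N)
      rw [Fintype.card_fin]
      linarith
    rw [Fintype.card_fin] at h
    have hY : 0 ≤ prob fun y => pairDiff p y ∈ W := prob_nonneg _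
    linarith
  have key := prob_span_mem_le (fun t : {s : Finset (Fin N) // s.card = k} => indVec t.1)
    (pairDiff p) (N := N) (m := m) (q := 1 - 1 / 1600) (by simp) hm (by norm_num)
    (fun W => ¬ ContainsDifferences s W ∧
      τ < prob fun t : {s : Finset (Fin N) // s.card = k} => indVec t.1 ∈ W)
    (fun W _ => pairDiff_mem_prob_pos W p) (fun W hW => hcomp W hW.1 hW.2)
  refine key ?_
  intro W hW W' hW'
  have h1 := hcomp W hW.1 hW.2
  have hfin : (Module.finrank ℝ W' : ℝ) + 1 ≤ m := by exact_mod_cast hW'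
  have h2 := prob_pairDiff_mem_le W' p hβ0 hγ1 hβγ hJ (by
    rw [Fintype.card_fin]
    linarith)
  rw [Fintype.card_fin] at h2
  have h3 : (m : ℝ) * prob (fun y => pairDiff p y ∈ W') ≤ m * (1 - γ / 2) ^ ℓ := by gcongr
  have hY : 0 ≤ prob fun y => pairDiff p y ∈ W := prob_nonneg _
  linarith [hW.2]

lemma prob_span_indVec_ne_top_le {N k ℓ s m : ℕ} {β γ τ c : ℝ} (hN : 0 < N) (hc0 : 0 < c)
    (hc1 : c ≤ 1) (hk : c * N ≤ k) (hk' : c * N ≤ (N : ℝ) - k)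
    (hℓ1 : 4 * (ℓ : ℝ) ≤ c * N) (hβ0 : 0 ≤ β) (hγ1 : γ ≤ 1)
    (hβγ : γ ≤ β ^ 2 / 2) (hℓ : 2 * (ℓ : ℝ) ≤ γ / 4 * N) (hs : γ * N ≤ s + 1) (hsN : s ≤ N)
    (hm : m ≤ N) (hmβ : (m : ℝ) ≤ (1 - β) * N + 1) (hτ0 : 0 ≤ τ)
    (hτ1 : 6400 * (1 - γ / 2) ^ ℓ ≤ τ) (hτ2 : 2 * m * (1 - γ / 2) ^ ℓ ≤ τ) :
    prob (fun f : Fin N → {s : Finset (Fin N) // s.card = k} =>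
      Submodule.span ℝ (Set.range ((fun t => indVec t.1) ∘ f)) ≠ ⊤) ≤
      N * τ + (N.choose s : ℝ) ^ 2 * (1 - c ^ 2) ^ (N - s) +
        2 * N.choose m * (1 - 1 / 1600) ^ m := by
  have hℓ1' : 4 * ℓ ≤ k := by
    have : 4 * (ℓ : ℝ) ≤ k := hℓ1.trans hk
    exact_mod_cast this
  have hℓ2 : k + 4 * ℓ ≤ N := by
    have : (k : ℝ) + 4 * ℓ ≤ N := by linarith
    exact_mod_cast this
  have : Nonempty {s : Finset (Fin N) // s.card = k} := by
    obtain ⟨t, -, ht⟩ := Finset.exists_subset_card_eq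
      (show k ≤ (Finset.univ : Finset (Fin N)).card by
        rw [Finset.card_univ, Fintype.card_fin]
        omega)
    exact ⟨⟨t, ht⟩⟩
  set x : {s : Finset (Fin N) // s.card = k} → Fin N → ℝ := fun t => indVec t.1
  have hlarge := prob_span_indVec_nondegenerate_le (N := N) (k := k) (ℓ := ℓ) (s := s)
    (m := m) (β := β) (γ := γ) (τ := τ) hN hℓ1' hℓ2 hβ0 hγ1 hβγ hℓ hs hsN hm hmβ hτ0 hτ1 hτ2
  have hsmall := prob_small_le hN x hτ0
  have hsparse := prob_containsDifferences_le x (θ := 1 - c ^ 2)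
    (sub_nonneg.2 (pow_le_one₀ hc0.le hc1))
    (fun W hW => prob_indVec_mem_le_one_sub_sq hc0 (by simpa using hN) (by simpa using hk)
      (by simpa using hk') hW) hsN
  set span : (Fin N → {s : Finset (Fin N) // s.card = k}) → Submodule ℝ (Fin N → ℝ) :=
    fun f => Submodule.span ℝ (Set.range (x ∘ f))
  have hunion : prob (fun f => span f ≠ ⊤) ≤ prob (fun f =>
      ((span f ≠ ⊤ ∧ prob (fun t => x t ∈ span f) ≤ τ) ∨
        (span f ≠ ⊤ ∧ ContainsDifferences s (span f))) ∨
      (¬ ContainsDifferences s (span f) ∧ τ < prob fun t => x t ∈ span f)) :=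
    prob_mono fun f hf => by
      by_cases h1 : prob (fun t => x t ∈ span f) ≤ τ
      · exact .inl (.inl ⟨hf, h1⟩)
      by_cases h2 : ContainsDifferences s (span f)
      · exact .inl (.inr ⟨hf, h2⟩)
      · exact .inr ⟨h2, not_le.1 h1⟩
  have h12 := prob_or_le (fun f => span f ≠ ⊤ ∧ prob (fun t => x t ∈ span f) ≤ τ)
    (fun f => span f ≠ ⊤ ∧ ContainsDifferences s (span f))
  exact hunion.trans ((prob_or_le _ _).trans
    (add_le_add (h12.trans (add_le_add hsmall hsparse)) hlarge))

lemma exists_prob_span_indVec_ne_top_le {c : ℝ} (hc0 : 0 < c) (hc1 : c < 1) :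
    ∃ θ : ℝ, 0 < θ ∧ θ < 1 ∧ ∀ᶠ N : ℕ in Filter.atTop, ∀ k : ℕ,
      c * N ≤ k → c * N ≤ (N : ℝ) - k →
      prob (fun f : Fin N → {s : Finset (Fin N) // s.card = k} =>
        Submodule.span ℝ (Set.range ((fun t => indVec t.1) ∘ f)) ≠ ⊤) ≤ θ ^ N := by
  obtain ⟨δ, hδ0, hδ1, θ₁, hθ₁0, hθ₁1, hδ⟩ := exists_choose_sq_mul_pow_le (q := 1 - c ^ 2)
    (sub_pos.2 (pow_lt_one₀ hc0.le hc1 two_ne_zero)) (sub_lt_self 1 (pow_pos hc0 2))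
  obtain ⟨β, hβ0, hβ1, θ₂, hθ₂0, hθ₂1, hβ⟩ :=
    exists_choose_sq_mul_pow_le (q := 1 - 1 / 1600) (by norm_num) (by norm_num)
  obtain ⟨γ, hγ0, hγδ, hγβ⟩ : ∃ γ : ℝ, 0 < γ ∧ γ ≤ δ ∧ γ ≤ β ^ 2 / 2 :=
    ⟨min δ (β ^ 2 / 2), lt_min hδ0 (by positivity), min_le_left _ _, min_le_right _ _⟩
  have hγ1 : γ ≤ 1 := hγδ.trans hδ1.le
  obtain ⟨η, hη0, hηc, hηγ⟩ : ∃ η : ℝ, 0 < η ∧ η ≤ c / 4 ∧ η ≤ γ / 8 :=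
    ⟨min (c / 4) (γ / 8), lt_min (by positivity) (by positivity), min_le_left _ _,
      min_le_right _ _⟩
  have ha : 1 / 2 ≤ 1 - γ / 2 := by linarith
  have ha0 : 0 < 1 - γ / 2 := by linarith
  obtain ⟨b, hb0, hb1, hb⟩ : ∃ b : ℝ, 0 < b ∧ b < 1 ∧ (1 - γ / 2) ^ η = b * b :=
    ⟨(1 - γ / 2) ^ (η / 2), Real.rpow_pos_of_pos ha0 _,
      Real.rpow_lt_one ha0.le (by linarith) (by positivity),
      by rw [← Real.rpow_add ha0, add_halves]⟩
  obtain ⟨θ, hθ0, hθ1, hθ⟩ := exists_eventually_add_pow_le hb0 hθ₁0 hθ₂0 hb1 hθ₁1 hθ₂1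
  refine ⟨θ, hθ0, hθ1, ?_⟩
  filter_upwards [hθ, eventually_mul_add_one_mul_pow_le 12800 hb0 hb1,
    Filter.eventually_gt_atTop 0] with N hθN hbN hN k hk hk'
  have hN0 : (0 : ℝ) ≤ N := N.cast_nonneg
  have hηN := Nat.floor_le (mul_nonneg hη0.le hN0)
  have hδN := Nat.floor_le (mul_nonneg hδ0.le hN0)
  have hβN := Nat.floor_le (mul_nonneg hβ0.le hN0)
  have hδN' := (Nat.lt_floor_add_one (δ * N)).le
  have hβN' := (Nat.lt_floor_add_one (β * N)).le
  have hηcN := mul_le_mul_of_nonneg_right hηc hN0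
  have hηγN := mul_le_mul_of_nonneg_right hηγ hN0
  have hγδN := mul_le_mul_of_nonneg_right hγδ hN0
  have hpow := pow_floor_le (η := η) ha (by linarith) N
  rw [hb, mul_pow] at hpow
  have hdN := hδ N _ hδN
  have hβN2 := hβ N _ hβN
  set ℓ := ⌊η * N⌋₊
  set s := ⌊δ * N⌋₊
  set r := ⌊β * N⌋₊
  have hsN : s ≤ N := by
    have : (s : ℝ) ≤ N := hδN.trans (mul_le_of_le_one_left hN0 hδ1.le)
    exact_mod_cast this
  have hrN : r ≤ N := by
    have : (r : ℝ) ≤ N := hβN.trans (mul_le_of_le_one_left hN0 hβ1.le)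
    exact_mod_cast this
  have hmN : ((N - r : ℕ) : ℝ) = N - r := Nat.cast_sub hrN
  have hr0 : (0 : ℝ) ≤ r := r.cast_nonneg
  have hbN0 : 0 ≤ b ^ N := pow_nonneg hb0.le N
  have hM : ∀ M : ℝ, M ≤ 6400 * (N + 1) → M * (1 - γ / 2) ^ ℓ ≤ b ^ N := fun M hM => by
    calc M * (1 - γ / 2) ^ ℓ ≤ 6400 * (N + 1) * (2 * (b ^ N * b ^ N)) := by gcongr
      _ = 12800 * (N + 1) * b ^ N * b ^ N := by ring
      _ ≤ 1 * b ^ N := by gcongr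
      _ = b ^ N := one_mul _
  have hch : (N.choose (N - r) : ℝ) ≤ (N.choose r : ℝ) ^ 2 := by
    rw [Nat.choose_symm hrN]
    exact_mod_cast Nat.le_self_pow two_ne_zero _
  have hβ' : 2 * (N.choose (N - r) : ℝ) * (1 - 1 / 1600) ^ (N - r) ≤ 2 * θ₂ ^ N := by
    rw [mul_assoc]
    refine mul_le_mul_of_nonneg_left (le_trans ?_ hβN2) two_pos.le
    exact mul_le_mul_of_nonneg_right hch (by norm_num)
  have := prob_span_indVec_ne_top_le (N := N) (k := k) (ℓ := ℓ) (s := s) (m := N - r) (β := β)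
    (γ := γ) (τ := b ^ N) hN hc0 hc1.le hk hk' (by linarith) hβ0.le hγ1 hγβ
    (by linarith) (by linarith) hsN (Nat.sub_le _ _) (by rw [hmN]; linarith) hbN0
    (hM _ (by linarith)) (hM _ (by rw [hmN]; linarith))
  linarith

lemma det_of_indicator_eq_zero_iff {N : ℕ} (g : Fin N → Finset (Fin N)) :
    (Matrix.of fun t j : Fin N => if j ∈ g t then (1 : ℝ) else 0).det = 0 ↔
      Submodule.span ℝ (Set.range fun t => indVec (g t)) ≠ ⊤ := by
  set A : Matrix (Fin N) (Fin N) ℝ := Matrix.of fun t j => if j ∈ g t then (1 : ℝ) else 0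
  have hrow : A.row = fun t => indVec (g t) := rfl
  rw [← hrow, ← not_iff_not, not_not, ← Ne, ← isUnit_iff_ne_zero, ← Matrix.isUnit_iff_isUnit_det,
    ← Matrix.linearIndependent_rows_iff_isUnit]
  constructor
  · intro h
    exact h.span_eq_top_of_card_eq_finrank' (by simp)
  · intro h
    exact linearIndependent_of_top_le_span_of_card_eq_finrank h.ge (by simp)

end Main

/-- Theorem 3, part 1: for every constant `c ∈ (0, 1/2]` there is `c' > 0` such that for all
`N, K` with `min(K, N-K) ≥ cN`, a random `N × N` matrix whose `N` rows are independent and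
uniformly distributed over the `0/1` vectors of weight exactly `K` is invertible over `ℝ`
with probability at least `1 - 2 e^{-c'N}`.  (The probability is the number of row-tuples,
i.e. functions from `Fin N` to `K`-subsets of `Fin N`, producing an invertible indicator
matrix, divided by the total number `C(N,K)^N` of row-tuples.) -/
theorem k_uniform_random_selection_full_rank :
    ∀ c : ℝ, 0 < c → c ≤ 1 / 2 →
      ∃ c' : ℝ, 0 < c' ∧ ∀ N K : ℕ,
        c * N ≤ (min K (N - K) : ℕ) →
        1 - 2 * Real.exp (-c' * N) ≤
          (Nat.card {f : Fin N → {s : Finset (Fin N) // s.card = K} //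
              (Matrix.of fun t j : Fin N => if j ∈ (f t).1 then (1 : ℝ) else 0).det ≠ 0} : ℝ)
            / ((N.choose K : ℝ) ^ N) := by
  intro c hc0 hc1
  obtain ⟨θ, hθ0, hθ1, hθ⟩ := exists_prob_span_indVec_ne_top_le hc0 (hc1.trans_lt (by norm_num))
  obtain ⟨N₀, hN₀⟩ := Filter.eventually_atTop.1 hθ
  have hlog : 0 < -Real.log θ := neg_pos.2 (Real.log_neg hθ0 hθ1)
  have hlog2 : 0 < Real.log 2 := Real.log_pos one_lt_two
  refine ⟨min (-Real.log θ) (Real.log 2 / (N₀ + 1)), lt_min hlog (by positivity),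
    fun N K hNK => ?_⟩
  set c' := min (-Real.log θ) (Real.log 2 / (N₀ + 1))
  have hc'1 : c' ≤ -Real.log θ := min_le_left _ _
  have hc'2 : c' ≤ Real.log 2 / (N₀ + 1) := min_le_right _ _
  rcases le_or_gt N N₀ with hle | hlt
  · have h1 : c' * N ≤ Real.log 2 := by
      have h2 : (N : ℝ) ≤ N₀ + 1 := by exact_mod_cast (by omega : N ≤ N₀ + 1)
      calc c' * N ≤ Real.log 2 / (N₀ + 1) * (N₀ + 1) := by gcongr
        _ = Real.log 2 := div_mul_cancel₀ _ (by positivity)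
    have h2 : Real.exp (-Real.log 2) ≤ Real.exp (-c' * N) := Real.exp_le_exp.2 (by linarith)
    rw [Real.exp_neg, Real.exp_log two_pos] at h2
    refine le_trans (b := 0) (by linarith) (by positivity)
  · have hmin1 : c * N ≤ K := hNK.trans (by exact_mod_cast min_le_left _ _)
    have hmin2 : c * N ≤ (N - K : ℕ) := hNK.trans (by exact_mod_cast min_le_right _ _)
    have hKN : K ≤ N := by
      have : (0 : ℝ) < (N - K : ℕ) :=
        (mul_pos hc0 (by exact_mod_cast hlt.pos)).trans_le hmin2
      have : 0 < N - K := by exact_mod_cast this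
      omega
    rw [Nat.cast_sub hKN] at hmin2
    have hprob := hN₀ N hlt.le K hmin1 hmin2
    have hθexp : θ ^ N ≤ Real.exp (-c' * N) := by
      rw [← Real.exp_log hθ0, ← Real.exp_nat_mul]
      refine Real.exp_le_exp.2 ?_
      rw [mul_comm]
      gcongr
      linarith
    have hne : Nonempty {s : Finset (Fin N) // s.card = K} := by
      obtain ⟨t, -, ht⟩ := Finset.exists_subset_card_eq
        (show K ≤ (Finset.univ : Finset (Fin N)).card by
          rwa [Finset.card_univ, Fintype.card_fin])
      exact ⟨⟨t, ht⟩⟩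
    have hcard : (Nat.card {f : Fin N → {s : Finset (Fin N) // s.card = K} //
        (Matrix.of fun t j : Fin N => if j ∈ (f t).1 then (1 : ℝ) else 0).det ≠ 0} : ℝ)
          / ((N.choose K : ℝ) ^ N) = 1 - prob (fun f : Fin N → {s : Finset (Fin N) // s.card = K} =>
        Submodule.span ℝ (Set.range ((fun t => indVec t.1) ∘ f)) ≠ ⊤) := by
      classical
      rw [← prob_not, prob_eq_card_div, Fintype.card_fun, Fintype.card_finset_len,
        Fintype.card_fin, Nat.card_eq_fintype_card, Fintype.card_subtype]
      push_cast
      congr 3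
      ext f
      simp only [Finset.mem_filter, Finset.mem_univ, true_and]
      exact not_congr (det_of_indicator_eq_zero_iff fun t => (f t).1)
    rw [hcard]
    have := Real.exp_pos (-c' * N)
    linarith
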